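/- Assume P satisfies power-law ψ-mixing with exponent α > 2. Fix ε > 0 and η with 4/5 < η < 4/3. Then there exist constants C, λ₀ > 0 such that for all 0 < λ < λ₀ one has |γ_λ(2 − ελ^η) − λ^{2−η}·D_V(0)/(8ε)| ≤ C·(λ^{4−5η/2} + λ^{3η/2} + λ^{(1−η/2)·(3α+2)/(α+2)}). -/

import Mathlib

open MeasureTheory Filter

noncomputable section

attribute [local instance] Matrix.normedAddCommGroup Matrix.normedSpace

/-- The shift by `n` on the configuration space `Σ^ℤ`: `(shiftn n ω) i = ω (i + n)`.
`shiftn 1` is the left shift `S`. -/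
def shiftn {A : Type*} (n : ℤ) (ω : ℤ → A) : ℤ → A := fun i => ω (i + n)

/-- A bounded function `g` on `Σ^ℤ` is quasi-local with rate `r` if its variation on the
window `[-m, n]` is bounded by `C(g) · r^(min m n)` for all `m, n ≥ 1`. -/
def QuasiLocal {A : Type*} {E : Type*} [SeminormedAddGroup E] (r : ℝ)
    (g : (ℤ → A) → E) : Prop :=
  ∃ C : ℝ, ∀ m n : ℕ, 1 ≤ m → 1 ≤ n → ∀ ω ω' : ℤ → A,
    (∀ i : ℤ, -(m : ℤ) ≤ i → i ≤ (n : ℤ) → ω i = ω' i) →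
    ‖g ω - g ω'‖ ≤ C * r ^ (min m n)

/-- Power-law ψ-mixing with exponent α: for all `k < l < m < n`, all bounded `g₁` measurable
w.r.t. the coordinates in `[k,l]` and bounded `g₂` measurable w.r.t. the coordinates in `[m,n]`,
`|E(g₁g₂) − E(g₁)E(g₂)| ≤ C·E(|g₁|)·E(|g₂|)·|m−l|^(−α)`. -/
def PowerMixing {A : Type*} [MeasurableSpace A] (P : Measure (ℤ → A)) (α : ℝ) : Prop :=
  ∃ C : ℝ, ∀ k l m n : ℤ, k < l → l < m → m < n →
    ∀ g₁ g₂ : (ℤ → A) → ℝ, Measurable g₁ → Measurable g₂ →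
      (∃ B, ∀ ω, |g₁ ω| ≤ B) → (∃ B, ∀ ω, |g₂ ω| ≤ B) →
      (∀ ω ω', (∀ i : ℤ, k ≤ i → i ≤ l → ω i = ω' i) → g₁ ω = g₁ ω') →
      (∀ ω ω', (∀ i : ℤ, m ≤ i → i ≤ n → ω i = ω' i) → g₂ ω = g₂ ω') →
      |(∫ ω, g₁ ω * g₂ ω ∂P) - (∫ ω, g₁ ω ∂P) * ∫ ω, g₂ ω ∂P| ≤
        C * (∫ ω, |g₁ ω| ∂P) * (∫ ω, |g₂ ω| ∂P) * (|(m : ℝ) - (l : ℝ)|) ^ (-α)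

/-- The transfer matrix `T^E_{λ,ω} = [[E − λV(ω), −1],[1, 0]]`. -/
def transferMat {A : Type*} (lam : ℝ) (V : (ℤ → A) → ℝ) (E : ℂ) (ω : ℤ → A) :
    Matrix (Fin 2) (Fin 2) ℂ :=
  !![E - (lam : ℂ) * (V ω : ℂ), -1; 1, 0]

/-- The product `T^E_{λ,S^Nω} ⋯ T^E_{λ,S²ω} T^E_{λ,Sω}` of transfer matrices. -/
def transferProd {A : Type*} (lam : ℝ) (V : (ℤ → A) → ℝ) (E : ℂ) :
    ℕ → (ℤ → A) → Matrix (Fin 2) (Fin 2) ℂ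
  | 0, _ => 1
  | n + 1, ω => transferMat lam V E (shiftn (n + 1) ω) * transferProd lam V E n ω

/-- `γ` is the Lyapunov exponent at energy `E`:
`γ = lim_{N→∞} (1/N)·E log‖T^E_{λ,S^Nω}⋯T^E_{λ,Sω}‖`. -/
def IsLyapunov {A : Type*} [MeasurableSpace A] (P : Measure (ℤ → A)) (lam : ℝ)
    (V : (ℤ → A) → ℝ) (E : ℂ) (γ : ℝ) : Prop :=
  Tendsto (fun N : ℕ => (N : ℝ)⁻¹ * ∫ ω, Real.log ‖transferProd lam V E N ω‖ ∂P)
    atTop (nhds γ)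

/-- The spectral density `D_V(k) = Σ_{n∈ℤ} e^{ikn} E(V·(V∘S^n))`. -/
def specDensity {A : Type*} [MeasurableSpace A] (P : Measure (ℤ → A))
    (V : (ℤ → A) → ℝ) (k : ℝ) : ℂ :=
  ∑' n : ℤ, Complex.exp (Complex.I * (k : ℂ) * (n : ℂ)) *
    ((∫ ω, V ω * V (shiftn n ω) ∂P : ℝ) : ℂ)

/-- The distance from `k` to the nearest point of `(π/2)·ℤ`. -/
def distHalfPi (k : ℝ) : ℝ := ⨅ j : ℤ, |k - Real.pi / 2 * (j : ℝ)|

/-! ### Cesàro bounds -/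

/-- The partial sums of `s` grow at most linearly with slope `e`. -/
def CesaroBound (s : ℕ → ℂ) (e : ℝ) : Prop :=
  ∃ K : ℝ, ∀ N : ℕ, ‖∑ n ∈ Finset.range N, s n‖ ≤ e * N + K

namespace CesaroBound

variable {s t : ℕ → ℂ} {e f : ℝ}

theorem of_norm_le (h : ∀ n, ‖s n‖ ≤ e) : CesaroBound s e :=
  ⟨0, fun N => by
    have := norm_sum_le_of_le (Finset.range N) (fun n _ => h n)
    simp only [Finset.sum_const, Finset.card_range, nsmul_eq_mul] at this
    linarith⟩

theorem add (hs : CesaroBound s e) (ht : CesaroBound t f) :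
    CesaroBound (fun n => s n + t n) (e + f) := by
  obtain ⟨K, hK⟩ := hs
  obtain ⟨K', hK'⟩ := ht
  refine ⟨K + K', fun N => ?_⟩
  rw [Finset.sum_add_distrib]
  have := norm_add_le (∑ n ∈ Finset.range N, s n) (∑ n ∈ Finset.range N, t n)
  linarith [hK N, hK' N]

theorem const_mul (a : ℂ) (hs : CesaroBound s e) :
    CesaroBound (fun n => a * s n) (‖a‖ * e) := by
  obtain ⟨K, hK⟩ := hs
  refine ⟨‖a‖ * K, fun N => ?_⟩
  rw [← Finset.mul_sum, norm_mul]
  have := mul_le_mul_of_nonneg_left (hK N) (norm_nonneg a)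
  linarith

theorem mono (hs : CesaroBound s e) (h : e ≤ f) : CesaroBound s f := by
  obtain ⟨K, hK⟩ := hs
  refine ⟨K, fun N => (hK N).trans ?_⟩
  gcongr

theorem finset_sum {ι : Type*} (I : Finset ι) {s : ι → ℕ → ℂ} {e : ι → ℝ}
    (h : ∀ i ∈ I, CesaroBound (s i) (e i)) :
    CesaroBound (fun n => ∑ i ∈ I, s i n) (∑ i ∈ I, e i) := by
  classical
  induction I using Finset.induction_on with
  | empty => exact ⟨0, fun N => by simp⟩
  | insert a I ha ih =>
    simp only [Finset.sum_insert ha]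
    exact (h a (Finset.mem_insert_self a I)).add
      (ih fun i hi => h i (Finset.mem_insert_of_mem hi))

theorem shift (k : ℕ) (hs : CesaroBound s e) : CesaroBound (fun n => s (n + k)) e := by
  obtain ⟨K, hK⟩ := hs
  refine ⟨e * k + K + ‖∑ n ∈ Finset.range k, s n‖, fun N => ?_⟩
  have h1 : ∑ n ∈ Finset.range N, s (n + k)
      = ∑ n ∈ Finset.range (N + k), s n - ∑ n ∈ Finset.range k, s n := by
    rw [add_comm N k, Finset.sum_range_add, add_sub_cancel_left]
    exact Finset.sum_congr rfl fun n _ => by rw [add_comm]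
  rw [h1]
  have h2 := norm_sub_le (∑ n ∈ Finset.range (N + k), s n) (∑ n ∈ Finset.range k, s n)
  have h3 := hK (N + k)
  push_cast at h3
  linarith

theorem of_shift (he : 0 ≤ e) (k : ℕ) (hs : CesaroBound (fun n => s (n + k)) e) :
    CesaroBound s e := by
  obtain ⟨K, hK⟩ := hs
  refine ⟨|K| + ∑ n ∈ Finset.range k, ‖s n‖, fun N => ?_⟩
  have h0 : 0 ≤ e * N := by positivity
  rcases le_total N k with h | h
  · have h1 := norm_sum_le (Finset.range N) s
    have h2 : ∑ n ∈ Finset.range N, ‖s n‖ ≤ ∑ n ∈ Finset.range k, ‖s n‖ :=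
      Finset.sum_le_sum_of_subset_of_nonneg (Finset.range_mono h) fun _ _ _ => norm_nonneg _
    linarith [abs_nonneg K]
  · obtain ⟨M, rfl⟩ := Nat.exists_eq_add_of_le h
    rw [Finset.sum_range_add]
    have h1 := norm_add_le (∑ n ∈ Finset.range k, s n) (∑ n ∈ Finset.range M, s (k + n))
    have h2 := norm_sum_le (Finset.range k) s
    have h3 := hK M
    have h4 : ∑ n ∈ Finset.range M, s (k + n) = ∑ n ∈ Finset.range M, s (n + k) :=
      Finset.sum_congr rfl fun n _ => by rw [add_comm]
    rw [h4] at h1 ⊢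
    have h5 : e * (M : ℝ) ≤ e * ((k + M : ℕ) : ℝ) := by
      push_cast
      gcongr
      linarith [(Nat.cast_nonneg k : (0:ℝ) ≤ k)]
    linarith [le_abs_self K]

/-- A bounded approximate solution of `s (n + 1) = w * s n` averages out. -/
theorem of_recursion {w : ℂ} (hw : w ≠ 1) {M : ℝ} (hM : ∀ n, ‖s n‖ ≤ M)
    (h : ∀ n, ‖s (n + 1) - w * s n‖ ≤ e) : CesaroBound s (e / ‖1 - w‖) := by
  have hw' : 0 < ‖1 - w‖ := norm_pos_iff.2 (sub_ne_zero.2 hw.symm)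
  refine ⟨2 * M / ‖1 - w‖, fun N => ?_⟩
  rw [div_mul_eq_mul_div, ← add_div, le_div_iff₀ hw', mul_comm, ← norm_mul]
  have h1 : (1 - w) * ∑ n ∈ Finset.range N, s n
      = ∑ n ∈ Finset.range N, (s (n + 1) - w * s n) - (s N - s 0) := by
    rw [← Finset.sum_range_sub, ← Finset.sum_sub_distrib, Finset.mul_sum]
    exact Finset.sum_congr rfl fun n _ => by ring
  rw [h1]
  have h2 := norm_sub_le (∑ n ∈ Finset.range N, (s (n + 1) - w * s n)) (s N - s 0)
  have h3 := norm_sum_le_of_le (Finset.range N) (fun n _ => h n)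
  simp only [Finset.sum_const, Finset.card_range, nsmul_eq_mul] at h3
  have h4 := norm_sub_le (s N) (s 0)
  linarith [hM N, hM 0]

theorem tendsto_re_le {u : ℕ → ℝ} {γ c : ℝ} (hs : CesaroBound (fun n => ((u n - c : ℝ) : ℂ)) e)
    (h : Tendsto (fun N : ℕ => (N : ℝ)⁻¹ * ∑ n ∈ Finset.range N, u n) atTop (nhds γ)) :
    |γ - c| ≤ e := by
  obtain ⟨K, hK⟩ := hs
  have h1 : Tendsto (fun N : ℕ => |(N : ℝ)⁻¹ * ∑ n ∈ Finset.range N, u n - c|) atTop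
      (nhds |γ - c|) := (h.sub_const c).abs
  have h2 : Tendsto (fun N : ℕ => e + K * (N : ℝ)⁻¹) atTop (nhds (e + K * 0)) :=
    (tendsto_inv_atTop_nhds_zero_nat.const_mul K).const_add e
  rw [mul_zero, add_zero] at h2
  refine le_of_tendsto_of_tendsto h1 h2 ?_
  filter_upwards [eventually_gt_atTop 0] with N hN
  have hN' : (0 : ℝ) < N := by exact_mod_cast hN
  have h3 := hK N
  rw [← Complex.ofReal_sum, Complex.norm_real, Real.norm_eq_abs, Finset.sum_sub_distrib] at h3
  simp only [Finset.sum_const, Finset.card_range, nsmul_eq_mul] at h3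
  have h4 : (N : ℝ)⁻¹ * ∑ n ∈ Finset.range N, u n - c
      = (N : ℝ)⁻¹ * (∑ n ∈ Finset.range N, u n - N * c) := by
    field_simp
  rw [h4, abs_mul, abs_of_pos (inv_pos.2 hN')]
  calc (N : ℝ)⁻¹ * |∑ n ∈ Finset.range N, u n - N * c| ≤ (N : ℝ)⁻¹ * (e * N + K) := by gcongr
    _ = e + K * (N : ℝ)⁻¹ := by field_simp

end CesaroBound

/-- Unrolling an approximate recursion `a (i + 1) ≈ w * a i + b i`. -/
theorem norm_sub_unrolled_le {a b : ℕ → ℂ} {e : ℕ → ℝ} {w : ℂ} (hw : ‖w‖ = 1) (L : ℕ)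
    (h : ∀ i < L, ‖a (i + 1) - w * (a i + b i)‖ ≤ e i) :
    ‖a L - w ^ L * a 0 - ∑ i ∈ Finset.range L, w ^ (L - i) * b i‖
      ≤ ∑ i ∈ Finset.range L, e i := by
  induction L with
  | zero => simp
  | succ L ih =>
    have h1 := ih fun i hi => h i (by omega)
    have h2 := h L (by omega)
    rw [Finset.sum_range_succ, Finset.sum_range_succ]
    have h3 : ∑ i ∈ Finset.range L, w ^ (L + 1 - i) * b i
        = w * ∑ i ∈ Finset.range L, w ^ (L - i) * b i := by
      rw [Finset.mul_sum]
      refine Finset.sum_congr rfl fun i hi => ?_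
      have : L + 1 - i = (L - i) + 1 := by have := Finset.mem_range.1 hi; omega
      rw [this, pow_succ]; ring
    have h4 : a (L + 1) - w ^ (L + 1) * a 0
        - (∑ i ∈ Finset.range L, w ^ (L + 1 - i) * b i + w ^ (L + 1 - L) * b L)
        = w * (a L - w ^ L * a 0 - ∑ i ∈ Finset.range L, w ^ (L - i) * b i)
          + (a (L + 1) - w * (a L + b L)) := by
      rw [h3, Nat.add_sub_cancel_left]; ring
    rw [h4]
    refine (norm_add_le _ _).trans ?_
    rw [norm_mul, hw, one_mul]
    exact add_le_add h1 h2

/-! ### The Möbius action on the unit disc -/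

/-- One step of the projective action of the transfer matrix, in the disc picture. -/
def diskMap (μ : ℂ) (v : ℝ) (z : ℂ) : ℂ :=
  μ * ((1 + z) / (1 + Complex.I * v * (1 + z)) - 1)

section DiskMap

variable {μ z z' : ℂ} {v v' : ℝ}

theorem norm_one_add_le_two (hz : ‖z‖ ≤ 1) : ‖1 + z‖ ≤ 2 := by
  have := norm_add_le (1 : ℂ) z
  rw [norm_one] at this
  linarith

theorem norm_I_mul_mul_le (hz : ‖z‖ ≤ 1) : ‖Complex.I * v * (1 + z)‖ ≤ 2 * |v| := by
  rw [norm_mul, norm_mul, Complex.norm_I, one_mul, Complex.norm_real, Real.norm_eq_abs, mul_comm]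
  gcongr
  exact norm_one_add_le_two hz

theorem le_norm_diskMap_denom (hz : ‖z‖ ≤ 1) :
    1 - 2 * |v| ≤ ‖1 + Complex.I * v * (1 + z)‖ := by
  have h := norm_sub_norm_le (1 : ℂ) (-(Complex.I * v * (1 + z)))
  rw [norm_one, norm_neg, sub_neg_eq_add] at h
  linarith [norm_I_mul_mul_le (v := v) hz]

theorem diskMap_denom_ne_zero (hz : ‖z‖ ≤ 1) (hv : |v| ≤ 1 / 8) :
    1 + Complex.I * v * (1 + z) ≠ 0 := by
  rw [← norm_pos_iff]
  linarith [le_norm_diskMap_denom (v := v) hz]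

theorem norm_diskMap_le_one (hμ : ‖μ‖ = 1) (hz : ‖z‖ ≤ 1) (hv : |v| ≤ 1 / 8) :
    ‖diskMap μ v z‖ ≤ 1 := by
  have h0 := diskMap_denom_ne_zero hz hv
  have h1 : (1 + z) / (1 + Complex.I * v * (1 + z)) - 1
      = (z - Complex.I * v * (1 + z)) / (1 + Complex.I * v * (1 + z)) := by
    rw [div_sub_one h0]
    congr 1
    ring
  rw [diskMap, norm_mul, hμ, one_mul, h1, norm_div]
  refine div_le_one_of_le₀ ?_ (norm_nonneg _)
  rw [← sq_le_sq₀ (norm_nonneg _) (norm_nonneg _), Complex.sq_norm, Complex.sq_norm]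
  have hz2 : Complex.normSq z ≤ 1 := by
    rw [← Complex.sq_norm]
    nlinarith [norm_nonneg z]
  simp only [Complex.normSq_apply, Complex.sub_re, Complex.sub_im, Complex.add_re, Complex.add_im,
    Complex.mul_re, Complex.mul_im, Complex.I_re, Complex.I_im, Complex.ofReal_re,
    Complex.ofReal_im, Complex.one_re, Complex.one_im] at hz2 ⊢
  nlinarith

theorem norm_diskMap_sub_le (hμ : ‖μ‖ = 1) (hz : ‖z‖ ≤ 1) (hz' : ‖z'‖ ≤ 1) {β : ℝ}
    (hβ : β ≤ 1 / 8) (hv : |v| ≤ β) (hv' : |v'| ≤ β) :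
    ‖diskMap μ v z - diskMap μ v' z'‖ ≤ (‖z - z'‖ + 4 * |v - v'|) / (1 - 2 * β) ^ 2 := by
  have h0 := diskMap_denom_ne_zero hz (hv.trans hβ)
  have h0' := diskMap_denom_ne_zero hz' (hv'.trans hβ)
  have h1 : diskMap μ v z - diskMap μ v' z'
      = μ * ((z - z' + Complex.I * (v' - v : ℝ) * (1 + z) * (1 + z')) /
        ((1 + Complex.I * v * (1 + z)) * (1 + Complex.I * v' * (1 + z')))) := by
    rw [diskMap, diskMap, ← mul_sub, sub_sub_sub_cancel_right, div_sub_div _ _ h0 h0']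
    congr 2
    push_cast
    ring
  rw [h1, norm_mul, hμ, one_mul, norm_div, norm_mul]
  have h2 := le_norm_diskMap_denom (v := v) hz
  have h3 := le_norm_diskMap_denom (v := v') hz'
  have h4 : (1 - 2 * β) ^ 2 ≤ ‖1 + Complex.I * v * (1 + z)‖ * ‖1 + Complex.I * v' * (1 + z')‖ := by
    rw [sq]
    apply mul_le_mul <;> linarith
  have h5 : ‖Complex.I * (v' - v : ℝ) * (1 + z) * (1 + z')‖ ≤ 4 * |v - v'| := by
    rw [norm_mul, norm_mul, norm_mul, Complex.norm_I, one_mul, Complex.norm_real,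
      Real.norm_eq_abs, abs_sub_comm]
    have := mul_le_mul (norm_one_add_le_two hz) (norm_one_add_le_two hz') (norm_nonneg _)
      (by norm_num)
    nlinarith [abs_nonneg (v - v')]
  have h6 : 0 < (1 - 2 * β) ^ 2 := by
    have : 0 < 1 - 2 * β := by linarith
    positivity
  gcongr
  exact (norm_add_le _ _).trans (by linarith)

theorem norm_diskMap_taylor_le (hz : ‖z‖ ≤ 1) (hv : |v| ≤ 1 / 8) :
    ‖((1 + z) / (1 + Complex.I * v * (1 + z)) - 1) - (z - Complex.I * v * (1 + z) ^ 2)‖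
      ≤ 16 * v ^ 2 := by
  have h0 := diskMap_denom_ne_zero hz hv
  have h1 : ((1 + z) / (1 + Complex.I * v * (1 + z)) - 1) - (z - Complex.I * v * (1 + z) ^ 2)
      = (Complex.I * v * (1 + z)) ^ 2 * (1 + z) / (1 + Complex.I * v * (1 + z)) := by
    rw [eq_div_iff h0, sub_mul, sub_mul, div_mul_cancel₀ _ h0]
    ring
  rw [h1, norm_div, norm_mul, norm_pow]
  have h2 := le_norm_diskMap_denom (v := v) hz
  have h3 := norm_I_mul_mul_le (v := v) hz
  have h4 := norm_one_add_le_two hz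
  rw [div_le_iff₀ (by linarith)]
  calc ‖Complex.I * v * (1 + z)‖ ^ 2 * ‖1 + z‖ ≤ (2 * |v|) ^ 2 * 2 := by gcongr
    _ = 8 * v ^ 2 := by rw [mul_pow, sq_abs]; ring
    _ ≤ 16 * v ^ 2 * ‖1 + Complex.I * v * (1 + z)‖ := by nlinarith [sq_nonneg v]

theorem norm_diskMap_pow_taylor_le (hμ : ‖μ‖ = 1) (hz : ‖z‖ ≤ 1) (hv : |v| ≤ 1 / 8) {q : ℕ}
    (hq : q ≤ 2) :
    ‖diskMap μ v z ^ (q + 1)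
        - μ ^ (q + 1) * (z ^ (q + 1) + -Complex.I * (q + 1) * v * (z ^ q * (1 + z) ^ 2))‖
      ≤ 120 * v ^ 2 := by
  set y : ℂ := (1 + z) / (1 + Complex.I * v * (1 + z)) - 1 with hy
  have hy1 : ‖y‖ ≤ 1 := by
    have := norm_diskMap_le_one hμ hz hv
    rwa [diskMap, norm_mul, hμ, one_mul] at this
  have he := norm_diskMap_taylor_le hz hv
  rw [← hy] at he
  have hs : ‖(1 + z) ^ 2‖ ≤ 4 := by
    rw [norm_pow]
    nlinarith [norm_one_add_le_two hz, norm_nonneg (1 + z)]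
  have hvs : ‖Complex.I * v * (1 + z) ^ 2‖ ≤ 4 * |v| := by
    rw [norm_mul, norm_mul, Complex.norm_I, one_mul, Complex.norm_real, Real.norm_eq_abs]
    nlinarith [abs_nonneg v]
  have hyz : ‖z - y‖ ≤ 6 * |v| := by
    have h1 : z - y = Complex.I * v * (1 + z) ^ 2 - (y - (z - Complex.I * v * (1 + z) ^ 2)) := by
      ring
    rw [h1]
    refine (norm_sub_le _ _).trans ?_
    have : 16 * v ^ 2 ≤ 2 * |v| := by
      rw [← sq_abs]
      nlinarith [abs_nonneg v]
    linarith
  have key : ∀ q : ℕ, ‖y ^ (q + 2) - (z ^ (q + 2) + -Complex.I * (q + 2) * v *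
        (z ^ (q + 1) * (1 + z) ^ 2))‖ ≤
      ‖y ^ (q + 1) - (z ^ (q + 1) + -Complex.I * (q + 1) * v * (z ^ q * (1 + z) ^ 2))‖
        + 16 * v ^ 2 + 24 * (q + 1) * v ^ 2 := by
    intro q
    have h1 : y ^ (q + 2) - (z ^ (q + 2) + -Complex.I * (q + 2) * v * (z ^ (q + 1) * (1 + z) ^ 2))
        = y * (y ^ (q + 1) - (z ^ (q + 1) + -Complex.I * (q + 1) * v * (z ^ q * (1 + z) ^ 2)))
          + z ^ (q + 1) * (y - (z - Complex.I * v * (1 + z) ^ 2))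
          + (q + 1 : ℕ) * z ^ q * (Complex.I * v * (1 + z) ^ 2) * (z - y) := by
      push_cast
      ring
    rw [h1]
    refine (norm_add₃_le).trans ?_
    have hzp : ∀ k, ‖z ^ k‖ ≤ 1 := fun k => by
      rw [norm_pow]
      exact pow_le_one₀ (norm_nonneg _) hz
    have h2 : ‖y * (y ^ (q + 1) - (z ^ (q + 1)
        + -Complex.I * (q + 1) * v * (z ^ q * (1 + z) ^ 2)))‖
        ≤ ‖y ^ (q + 1) - (z ^ (q + 1) + -Complex.I * (q + 1) * v * (z ^ q * (1 + z) ^ 2))‖ := by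
      rw [norm_mul]
      exact mul_le_of_le_one_left (norm_nonneg _) hy1
    have h3 : ‖z ^ (q + 1) * (y - (z - Complex.I * v * (1 + z) ^ 2))‖ ≤ 16 * v ^ 2 := by
      rw [norm_mul]
      exact (mul_le_of_le_one_left (norm_nonneg _) (hzp _)).trans he
    have h4 : ‖(q + 1 : ℕ) * z ^ q * (Complex.I * v * (1 + z) ^ 2) * (z - y)‖
        ≤ 24 * (q + 1) * v ^ 2 := by
      rw [norm_mul, norm_mul, norm_mul, Complex.norm_natCast]
      calc ((q + 1 : ℕ) : ℝ) * ‖z ^ q‖ * ‖Complex.I * v * (1 + z) ^ 2‖ * ‖z - y‖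
          ≤ ((q + 1 : ℕ) : ℝ) * 1 * (4 * |v|) * (6 * |v|) := by
            gcongr
            exact hzp q
        _ = 24 * (q + 1) * v ^ 2 := by
            rw [← sq_abs v]
            push_cast
            ring
    linarith
  have e0 : ‖y ^ (0 + 1) - (z ^ (0 + 1) + -Complex.I * ((0 : ℕ) + 1) * v *
      (z ^ 0 * (1 + z) ^ 2))‖ ≤ 16 * v ^ 2 := by
    refine le_of_eq_of_le (congrArg norm ?_) he
    push_cast
    ring
  have e1 := key 0
  have e2 := key 1
  have h1 : diskMap μ v z ^ (q + 1)
        - μ ^ (q + 1) * (z ^ (q + 1) + -Complex.I * (q + 1) * v * (z ^ q * (1 + z) ^ 2))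
      = μ ^ (q + 1) *
        (y ^ (q + 1) - (z ^ (q + 1) + -Complex.I * (q + 1) * v * (z ^ q * (1 + z) ^ 2))) := by
    rw [diskMap, mul_pow, ← mul_sub]
  rw [h1, norm_mul, norm_pow, hμ, one_pow, one_mul]
  have hv2 := sq_nonneg v
  push_cast at e0 e1 e2
  norm_num at e0 e1 e2
  interval_cases q
  · push_cast; norm_num; linarith
  · push_cast; norm_num; linarith
  · push_cast; norm_num; linarith

theorem abs_log_norm_sub_le {w : ℂ} (hw : ‖w‖ ≤ 1 / 2) :
    |Real.log ‖1 + w‖ - (w - w ^ 2 / 2).re| ≤ ‖w‖ ^ 3 := by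
  have h := Complex.norm_log_sub_logTaylor_le 2 (z := w) (by linarith)
  have h1 : Complex.logTaylor 3 w = w - w ^ 2 / 2 := by
    simp [Complex.logTaylor_succ, Complex.logTaylor_zero]
    ring
  rw [show 2 + 1 = 3 from rfl, h1] at h
  have h2 := (Complex.abs_re_le_norm _).trans h
  rw [Complex.sub_re, Complex.log_re] at h2
  refine h2.trans ?_
  have h3 : (1 - ‖w‖)⁻¹ ≤ 2 := by
    rw [inv_le_comm₀ (by linarith) (by norm_num)]
    linarith
  have h4 : 0 ≤ ‖w‖ ^ 3 := by positivity
  push_cast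
  norm_num
  nlinarith

end DiskMap

/-! ### Decorrelation of quasi-local observables -/

theorem exists_pow_le_mul_rpow_neg {r α : ℝ} (hr : 0 < r) (hr1 : r < 1) :
    ∃ K ≥ 0, ∀ g : ℕ, 1 ≤ g → r ^ ((g - 1) / 3) ≤ K * (g : ℝ) ^ (-α) := by
  obtain ⟨k, hk⟩ := exists_nat_ge α
  set ρ : ℝ := r ^ (3⁻¹ : ℝ) with hρ
  have hρ0 : 0 < ρ := Real.rpow_pos_of_pos hr _
  have hρ1 : ρ < 1 := Real.rpow_lt_one hr.le hr1 (by norm_num)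
  have hρ3 : ρ ^ 3 = r := by
    rw [hρ, ← Real.rpow_natCast, ← Real.rpow_mul hr.le]
    norm_num
  have ht := tendsto_pow_const_mul_const_pow_of_abs_lt_one k (r := ρ) (by rwa [abs_of_pos hρ0])
  obtain ⟨K, hK⟩ := ht.bddAbove_range
  have hK' : ∀ n : ℕ, (n : ℝ) ^ k * ρ ^ n ≤ K := fun n => hK ⟨n, rfl⟩
  have hK0 : 0 ≤ K := by
    refine le_trans ?_ (hK' 0)
    positivity
  refine ⟨K / ρ ^ 3, by positivity, fun g hg => ?_⟩
  have hg' : (1 : ℝ) ≤ g := by exact_mod_cast hg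
  have h1 : (g : ℝ) ^ α ≤ (g : ℝ) ^ k := by
    rw [← Real.rpow_natCast]
    exact Real.rpow_le_rpow_of_exponent_le hg' hk
  have h2 : r ^ ((g - 1) / 3) * ρ ^ 3 ≤ ρ ^ g := by
    rw [← hρ3, ← pow_mul, ← pow_add]
    exact pow_le_pow_of_le_one hρ0.le hρ1.le (by omega)
  have h3 : 0 < (g : ℝ) ^ α := by positivity
  rw [Real.rpow_neg (by positivity), ← div_eq_mul_inv, le_div_iff₀ h3, le_div_iff₀ (by positivity)]
  calc r ^ ((g - 1) / 3) * (g : ℝ) ^ α * ρ ^ 3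
      = (g : ℝ) ^ α * (r ^ ((g - 1) / 3) * ρ ^ 3) := by ring
    _ ≤ (g : ℝ) ^ k * ρ ^ g := by gcongr
    _ ≤ K := hK' g

section Locality

variable {A : Type*} {E : Type*} [NormedAddCommGroup E]

/-- Configurations agreeing on the window `[lo, hi]`. -/
def AgreeOn (lo hi : ℤ) (ω ω' : ℤ → A) : Prop := ∀ i : ℤ, lo ≤ i → i ≤ hi → ω i = ω' i

/-- `F` depends exponentially little on the coordinates far to the right of `a`. -/
def PastLocal (r C : ℝ) (a : ℤ) (F : (ℤ → A) → E) : Prop :=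
  ∀ d : ℕ, ∃ lo : ℤ, ∀ ω ω', AgreeOn lo (a + d) ω ω' → ‖F ω - F ω'‖ ≤ C * r ^ d

/-- `F` depends exponentially little on the coordinates far to the left of `b`. -/
def FutureLocal (r C : ℝ) (b : ℤ) (F : (ℤ → A) → E) : Prop :=
  ∀ d : ℕ, ∃ hi : ℤ, ∀ ω ω', AgreeOn (b - d) hi ω ω' → ‖F ω - F ω'‖ ≤ C * r ^ d

/-- Replace all coordinates outside of the window `[lo, hi]` by `a₀`. -/
def truncWindow (a₀ : A) (lo hi : ℤ) (ω : ℤ → A) : ℤ → A :=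
  fun i => if lo ≤ i ∧ i ≤ hi then ω i else a₀

theorem agreeOn_truncWindow (a₀ : A) {lo hi lo' hi' : ℤ} (h : lo ≤ lo') (h' : hi' ≤ hi)
    (ω : ℤ → A) : AgreeOn lo' hi' ω (truncWindow a₀ lo hi ω) := fun i h1 h2 => by
  rw [truncWindow, if_pos ⟨h.trans h1, h2.trans h'⟩]

theorem truncWindow_congr (a₀ : A) {lo hi : ℤ} {ω ω' : ℤ → A}
    (h : ∀ i : ℤ, lo ≤ i → i ≤ hi → ω i = ω' i) :
    truncWindow a₀ lo hi ω = truncWindow a₀ lo hi ω' := by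
  funext i
  by_cases hi' : lo ≤ i ∧ i ≤ hi
  · simp [truncWindow, hi', h i hi'.1 hi'.2]
  · simp [truncWindow, hi']

theorem measurable_truncWindow [MeasurableSpace A] (a₀ : A) (lo hi : ℤ) :
    Measurable (truncWindow a₀ lo hi) := by
  refine measurable_pi_lambda _ fun i => ?_
  by_cases h : lo ≤ i ∧ i ≤ hi
  · simpa [truncWindow, h] using measurable_pi_apply i
  · simp [truncWindow, h]

theorem measurable_shiftn [MeasurableSpace A] (n : ℤ) : Measurable (shiftn (A := A) n) :=
  measurable_pi_lambda _ fun i => measurable_pi_apply (i + n)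

end Locality

theorem integrable_of_measurable_of_norm_le {Ω : Type*} [MeasurableSpace Ω] {P : Measure Ω}
    [IsProbabilityMeasure P] {E : Type*} [NormedAddCommGroup E] [MeasurableSpace E] [BorelSpace E]
    [SecondCountableTopology E] {F : Ω → E} (hF : Measurable F) {M : ℝ} (h : ∀ ω, ‖F ω‖ ≤ M) :
    Integrable F P :=
  Integrable.of_bound hF.aestronglyMeasurable M (ae_of_all _ h)

theorem norm_integral_le_of_forall_norm_le {Ω : Type*} [MeasurableSpace Ω] {P : Measure Ω}
    [IsProbabilityMeasure P] {E : Type*} [NormedAddCommGroup E] [NormedSpace ℝ E] {F : Ω → E}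
    {M : ℝ} (h : ∀ ω, ‖F ω‖ ≤ M) : ‖∫ ω, F ω ∂P‖ ≤ M := by
  have := norm_integral_le_of_norm_le_const (μ := P) (ae_of_all _ h)
  simpa using this

section Mixing

variable {A : Type*} [MeasurableSpace A] {P : Measure (ℤ → A)} [IsProbabilityMeasure P]

theorem exists_decorrelation {α r : ℝ} (hmix : PowerMixing P α) (hα : 0 ≤ α) (hr : 0 < r)
    (hr1 : r < 1) {M C : ℝ} (hM : 0 ≤ M) (hC : 0 ≤ C) :
    ∃ K ≥ 0, ∀ (a : ℤ) (g : ℕ), 1 ≤ g → ∀ F H : (ℤ → A) → ℝ, Measurable F → Measurable H →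
      (∀ ω, |F ω| ≤ M) → (∀ ω, |H ω| ≤ M) → PastLocal r C a F → FutureLocal r C (a + g) H →
      |(∫ ω, F ω * H ω ∂P) - (∫ ω, F ω ∂P) * ∫ ω, H ω ∂P| ≤ K * (g : ℝ) ^ (-α) := by
  obtain ⟨Cm, hCm⟩ := hmix
  obtain ⟨K₀, hK₀, hpow⟩ := exists_pow_le_mul_rpow_neg (α := α) hr hr1
  refine ⟨|Cm| * M * M * 3 ^ α + 4 * M * C * K₀, by positivity, ?_⟩
  intro a g hg F H hFm hHm hFb hHb hFl hHl
  obtain ⟨ω₀⟩ := P.nonempty_of_neZero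
  set d := (g - 1) / 3 with hd
  obtain ⟨lo, hlo⟩ := hFl d
  obtain ⟨hi, hhi⟩ := hHl d
  set k := min lo (a + d - 1) with hk
  set n := max hi (a + g - d + 1) with hn
  set F' : (ℤ → A) → ℝ := fun ω => F (truncWindow (ω₀ 0) k (a + d) ω) with hF'
  set H' : (ℤ → A) → ℝ := fun ω => H (truncWindow (ω₀ 0) (a + g - d) n ω) with hH'
  have hF'm : Measurable F' := hFm.comp (measurable_truncWindow _ _ _)
  have hH'm : Measurable H' := hHm.comp (measurable_truncWindow _ _ _)
  have hFF' : ∀ ω, |F ω - F' ω| ≤ C * r ^ d := fun ω =>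
    hlo _ _ (agreeOn_truncWindow _ (min_le_left _ _) le_rfl ω)
  have hHH' : ∀ ω, |H ω - H' ω| ≤ C * r ^ d := fun ω =>
    hhi _ _ (agreeOn_truncWindow _ le_rfl (le_max_left _ _) ω)
  have hgd : 2 * d + 1 ≤ g := by omega
  have hgd3 : g ≤ 3 * (g - 2 * d) := by omega
  have hm := hCm k (a + d) (a + g - d) n (by omega) (by omega) (by omega) F' H' hF'm hH'm
    ⟨M, fun ω => hFb _⟩ ⟨M, fun ω => hHb _⟩
    (fun ω ω' h => by simp only [hF', truncWindow_congr _ h])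
    (fun ω ω' h => by simp only [hH', truncWindow_congr _ h])
  have iF := integrable_of_measurable_of_norm_le (P := P) hFm hFb
  have iH := integrable_of_measurable_of_norm_le (P := P) hHm hHb
  have iF' := integrable_of_measurable_of_norm_le (P := P) hF'm (fun ω => hFb _)
  have iH' := integrable_of_measurable_of_norm_le (P := P) hH'm (fun ω => hHb _)
  have bFH : ∀ ω, ‖F ω * H ω‖ ≤ M * M := fun ω => by
    rw [norm_mul]
    exact mul_le_mul (hFb ω) (hHb ω) (norm_nonneg _) hM
  have bFH' : ∀ ω, ‖F' ω * H' ω‖ ≤ M * M := fun ω => by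
    rw [norm_mul]
    exact mul_le_mul (hFb _) (hHb _) (norm_nonneg _) hM
  have iFH : Integrable (fun ω => F ω * H ω) P :=
    integrable_of_measurable_of_norm_le (P := P) (hFm.mul hHm) bFH
  have iFH' : Integrable (fun ω => F' ω * H' ω) P :=
    integrable_of_measurable_of_norm_le (P := P) (hF'm.mul hH'm) bFH'
  have hCr : 0 ≤ C * r ^ d := by positivity
  have e1 : |(∫ ω, F ω * H ω ∂P) - ∫ ω, F' ω * H' ω ∂P| ≤ 2 * M * (C * r ^ d) := by
    rw [← integral_sub iFH iFH', ← Real.norm_eq_abs]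
    refine norm_integral_le_of_forall_norm_le fun ω => ?_
    have : F ω * H ω - F' ω * H' ω = F ω * (H ω - H' ω) + (F ω - F' ω) * H' ω := by ring
    rw [this]
    refine (norm_add_le _ _).trans ?_
    rw [norm_mul, norm_mul]
    have h1 := mul_le_mul (hFb ω) (hHH' ω) (abs_nonneg _) hM
    have h2 := mul_le_mul (hFF' ω) (hHb (truncWindow (ω₀ 0) (a + g - d) n ω)) (abs_nonneg _) hCr
    simp only [Real.norm_eq_abs]
    linarith
  have bF : |∫ ω, F ω ∂P| ≤ M := by
    rw [← Real.norm_eq_abs]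
    exact norm_integral_le_of_forall_norm_le hFb
  have bH' : |∫ ω, H' ω ∂P| ≤ M := by
    rw [← Real.norm_eq_abs]
    exact norm_integral_le_of_forall_norm_le fun ω => hHb _
  have e2 : |(∫ ω, F ω ∂P) - ∫ ω, F' ω ∂P| ≤ C * r ^ d := by
    rw [← integral_sub iF iF', ← Real.norm_eq_abs]
    exact norm_integral_le_of_forall_norm_le hFF'
  have e3 : |(∫ ω, H ω ∂P) - ∫ ω, H' ω ∂P| ≤ C * r ^ d := by
    rw [← integral_sub iH iH', ← Real.norm_eq_abs]
    exact norm_integral_le_of_forall_norm_le hHH'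
  have e4 : |(∫ ω, F ω ∂P) * (∫ ω, H ω ∂P) - (∫ ω, F' ω ∂P) * ∫ ω, H' ω ∂P|
      ≤ 2 * M * (C * r ^ d) := by
    have : (∫ ω, F ω ∂P) * (∫ ω, H ω ∂P) - (∫ ω, F' ω ∂P) * ∫ ω, H' ω ∂P
      = (∫ ω, F ω ∂P) * ((∫ ω, H ω ∂P) - ∫ ω, H' ω ∂P)
        + ((∫ ω, F ω ∂P) - ∫ ω, F' ω ∂P) * ∫ ω, H' ω ∂P := by ring
    rw [this]
    refine (abs_add_le _ _).trans ?_
    rw [abs_mul, abs_mul]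
    have h1 := mul_le_mul bF e3 (abs_nonneg _) hM
    have h2 := mul_le_mul e2 bH' (abs_nonneg _) hCr
    linarith
  have aF' : |∫ ω, |F' ω| ∂P| ≤ M := by
    rw [← Real.norm_eq_abs]
    exact norm_integral_le_of_forall_norm_le fun ω => by simpa using hFb _
  have aH' : |∫ ω, |H' ω| ∂P| ≤ M := by
    rw [← Real.norm_eq_abs]
    exact norm_integral_le_of_forall_norm_le fun ω => by simpa using hHb _
  have e5 : |(∫ ω, F' ω * H' ω ∂P) - (∫ ω, F' ω ∂P) * ∫ ω, H' ω ∂P|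
      ≤ |Cm| * M * M * 3 ^ α * (g : ℝ) ^ (-α) := by
    refine hm.trans ((le_abs_self _).trans ?_)
    have hx : |((a + g - d : ℤ) : ℝ) - ((a + d : ℤ) : ℝ)| = ((g - 2 * d : ℕ) : ℝ) := by
      rw [Nat.cast_sub (by omega)]
      push_cast
      rw [abs_of_nonneg]
      · ring
      · have : ((2 * d + 1 : ℕ) : ℝ) ≤ g := by exact_mod_cast hgd
        push_cast at this
        linarith
    have hg0 : (0 : ℝ) < g := by exact_mod_cast hg
    have hx3 : (g : ℝ) / 3 ≤ ((g - 2 * d : ℕ) : ℝ) := by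
      have : ((g : ℕ) : ℝ) ≤ ((3 * (g - 2 * d) : ℕ) : ℝ) := by exact_mod_cast hgd3
      rw [Nat.cast_mul] at this
      push_cast at this ⊢
      linarith
    have hy : ((g - 2 * d : ℕ) : ℝ) ^ (-α) ≤ 3 ^ α * (g : ℝ) ^ (-α) := by
      refine (Real.rpow_le_rpow_of_nonpos (by positivity) hx3 (by linarith)).trans (le_of_eq ?_)
      rw [Real.div_rpow hg0.le (by norm_num), Real.rpow_neg (by norm_num : (0:ℝ) ≤ 3), div_inv_eq_mul,
        mul_comm]
    rw [hx, abs_mul, abs_mul, abs_mul, abs_of_nonneg (a := ((g - 2 * d : ℕ) : ℝ) ^ (-α))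
      (by positivity)]
    calc |Cm| * |∫ ω, |F' ω| ∂P| * |∫ ω, |H' ω| ∂P| * ((g - 2 * d : ℕ) : ℝ) ^ (-α)
        ≤ |Cm| * M * M * (3 ^ α * (g : ℝ) ^ (-α)) := by gcongr
      _ = _ := by ring
  have e6 : r ^ d ≤ K₀ * (g : ℝ) ^ (-α) := hpow g hg
  have e7 : 4 * M * (C * r ^ d) ≤ 4 * M * C * K₀ * (g : ℝ) ^ (-α) := by
    calc 4 * M * (C * r ^ d) = 4 * M * C * r ^ d := by ring
      _ ≤ 4 * M * C * (K₀ * (g : ℝ) ^ (-α)) := by gcongr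
      _ = _ := by ring
  rw [abs_le] at *
  constructor <;> linarith [e1.1, e1.2, e4.1, e4.2, e5.1, e5.2]

theorem exists_decorrelation_complex {α r : ℝ} (hmix : PowerMixing P α) (hα : 0 ≤ α) (hr : 0 < r)
    (hr1 : r < 1) {M C : ℝ} (hM : 0 ≤ M) (hC : 0 ≤ C) :
    ∃ K ≥ 0, ∀ (a : ℤ) (g : ℕ), 1 ≤ g → ∀ (F : (ℤ → A) → ℂ) (H : (ℤ → A) → ℝ),
      Measurable F → Measurable H →
      (∀ ω, ‖F ω‖ ≤ M) → (∀ ω, |H ω| ≤ M) → PastLocal r C a F → FutureLocal r C (a + g) H →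
      ‖(∫ ω, (H ω : ℂ) * F ω ∂P) - ((∫ ω, H ω ∂P : ℝ) : ℂ) * ∫ ω, F ω ∂P‖
        ≤ K * (g : ℝ) ^ (-α) := by
  obtain ⟨K, hK0, hK⟩ := exists_decorrelation (P := P) hmix hα hr hr1 hM hC
  refine ⟨2 * K, by positivity, fun a g hg F H hFm hHm hFb hHb hFl hHl => ?_⟩
  have iF := integrable_of_measurable_of_norm_le (P := P) hFm hFb
  have iHF : Integrable (fun ω => (H ω : ℂ) * F ω) P := by
    refine integrable_of_measurable_of_norm_le (M := M * M)
      ((Complex.measurable_ofReal.comp hHm).mul hFm) fun ω => ?_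
    rw [norm_mul, Complex.norm_real]
    exact mul_le_mul (hHb ω) (hFb ω) (norm_nonneg _) hM
  have hre := hK a g hg (fun ω => (F ω).re) H (Complex.measurable_re.comp hFm) hHm
    (fun ω => (Complex.abs_re_le_norm _).trans (hFb ω)) hHb
    (fun d => (hFl d).imp fun lo h ω ω' hω => by
      rw [← Complex.sub_re]; exact (Complex.abs_re_le_norm _).trans (h ω ω' hω)) hHl
  have him := hK a g hg (fun ω => (F ω).im) H (Complex.measurable_im.comp hFm) hHm
    (fun ω => (Complex.abs_im_le_norm _).trans (hFb ω)) hHb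
    (fun d => (hFl d).imp fun lo h ω ω' hω => by
      rw [← Complex.sub_im]; exact (Complex.abs_im_le_norm _).trans (h ω ω' hω)) hHl
  have r1 : (∫ ω, F ω ∂P).re = ∫ ω, (F ω).re ∂P :=
    (Complex.reCLM.integral_comp_comm iF).symm
  have r2 : (∫ ω, F ω ∂P).im = ∫ ω, (F ω).im ∂P :=
    (Complex.imCLM.integral_comp_comm iF).symm
  have r3 : (∫ ω, (H ω : ℂ) * F ω ∂P).re = ∫ ω, (F ω).re * H ω ∂P := by
    refine (Complex.reCLM.integral_comp_comm iHF).symm.trans (integral_congr_ae (ae_of_all _ ?_))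
    intro ω
    simp [mul_comm]
  have r4 : (∫ ω, (H ω : ℂ) * F ω ∂P).im = ∫ ω, (F ω).im * H ω ∂P := by
    refine (Complex.imCLM.integral_comp_comm iHF).symm.trans (integral_congr_ae (ae_of_all _ ?_))
    intro ω
    simp [mul_comm]
  refine (Complex.norm_le_abs_re_add_abs_im _).trans ?_
  rw [Complex.sub_re, Complex.sub_im, Complex.re_ofReal_mul, Complex.im_ofReal_mul, r1, r2, r3, r4,
    mul_comm (∫ ω, H ω ∂P), mul_comm (∫ ω, H ω ∂P)]
  linarith

end Mixing

/-! ### The disc orbit driven by a quasi-local potential -/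

section Orbit

variable {A : Type*}

/-- The potential along the orbit of the shift, starting at `S ω`. -/
def orbitPotential (V : (ℤ → A) → ℝ) (n : ℕ) (ω : ℤ → A) : ℝ := V (shiftn (n + 1) ω)

/-- The orbit of `0` under the projective action of the transfer matrices on the disc. -/
def diskOrbit (μ : ℂ) (d : ℝ) (V : (ℤ → A) → ℝ) : ℕ → (ℤ → A) → ℂ
  | 0, _ => 0
  | n + 1, ω => diskMap μ (d * orbitPotential V n ω) (diskOrbit μ d V n ω)

theorem shiftn_shiftn (m n : ℤ) (ω : ℤ → A) : shiftn m (shiftn n ω) = shiftn (m + n) ω := by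
  funext i
  simp only [shiftn, add_assoc]

theorem shiftn_zero (ω : ℤ → A) : shiftn 0 ω = ω := by
  funext i
  simp only [shiftn, add_zero]

theorem measurePreserving_shiftn [MeasurableSpace A] {P : Measure (ℤ → A)}
    (hinv : MeasurePreserving (shiftn 1) P P) (n : ℕ) : MeasurePreserving (shiftn n) P P := by
  induction n with
  | zero =>
    have : shiftn (A := A) ((0 : ℕ) : ℤ) = id := funext shiftn_zero
    rw [this]
    exact MeasurePreserving.id P
  | succ n ih =>
    have : shiftn (A := A) ((n + 1 : ℕ) : ℤ) = shiftn 1 ∘ shiftn n := by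
      funext ω
      rw [Function.comp, shiftn_shiftn]
      push_cast
      rw [add_comm]
    rw [this]
    exact hinv.comp ih

theorem integral_comp_shiftn [MeasurableSpace A] {P : Measure (ℤ → A)}
    (hinv : MeasurePreserving (shiftn 1) P P) (n : ℕ) {g : (ℤ → A) → ℝ} (hg : Measurable g) :
    ∫ ω, g (shiftn n ω) ∂P = ∫ ω, g ω ∂P := by
  have h := measurePreserving_shiftn hinv n
  conv_rhs => rw [← h.map_eq]
  rw [integral_map h.measurable.aemeasurable hg.aestronglyMeasurable]

variable {V : (ℤ → A) → ℝ} {r B Cv : ℝ}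

theorem measurable_orbitPotential [MeasurableSpace A] (hV : Measurable V) (n : ℕ) :
    Measurable (orbitPotential V n) :=
  hV.comp (measurable_shiftn _)

theorem measurable_diskOrbit [MeasurableSpace A] (hV : Measurable V) (μ : ℂ) (d : ℝ) (n : ℕ) :
    Measurable (diskOrbit μ d V n) := by
  induction n with
  | zero => exact measurable_const
  | succ n ih =>
    have h := measurable_orbitPotential hV n
    change Measurable fun ω => diskMap μ (d * orbitPotential V n ω) (diskOrbit μ d V n ω)
    unfold diskMap
    fun_prop

theorem integral_orbitPotential_mul [MeasurableSpace A] {P : Measure (ℤ → A)}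
    (hinv : MeasurePreserving (shiftn 1) P P) (hV : Measurable V) (m j : ℕ) :
    ∫ ω, orbitPotential V (m + j) ω * orbitPotential V m ω ∂P
      = ∫ ω, V ω * V (shiftn j ω) ∂P := by
  have hg : Measurable fun ω => V ω * V (shiftn j ω) :=
    hV.mul (hV.comp (measurable_shiftn _))
  rw [← integral_comp_shiftn hinv (m + 1) hg]
  refine integral_congr_ae (ae_of_all _ fun ω => ?_)
  simp only [orbitPotential, shiftn_shiftn]
  push_cast
  rw [mul_comm, show (j : ℤ) + (m + 1) = m + j + 1 by ring]

/-- The locality of the potential, in a form that includes the trivial window. -/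
theorem QuasiLocal.exists_bound (hql : QuasiLocal r V) (hr : 0 < r) (hb : ∃ B, ∀ ω, |V ω| ≤ B) :
    ∃ C ≥ 0, ∀ (i lo hi : ℤ) (d : ℕ) (ω ω' : ℤ → A), lo ≤ i - d → i + d ≤ hi →
      AgreeOn lo hi ω ω' → |V (shiftn i ω) - V (shiftn i ω')| ≤ C * r ^ d := by
  obtain ⟨C, hC⟩ := hql
  obtain ⟨B, hB⟩ := hb
  refine ⟨|C| + 2 * |B|, by positivity, fun i lo hi d ω ω' h1 h2 h => ?_⟩
  rcases Nat.eq_zero_or_pos d with rfl | hd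
  · have h3 := abs_sub (V (shiftn i ω)) (V (shiftn i ω'))
    rw [pow_zero, mul_one]
    linarith [hB (shiftn i ω), hB (shiftn i ω'), le_abs_self B, abs_nonneg C]
  · have h3 := hC d d hd hd (shiftn i ω) (shiftn i ω') fun j hj hj' =>
      h (j + i) (by omega) (by omega)
    rw [min_self, Real.norm_eq_abs] at h3
    refine h3.trans ?_
    gcongr
    linarith [le_abs_self C, abs_nonneg B]

theorem norm_diskOrbit_le_one {μ : ℂ} {d : ℝ} (hμ : ‖μ‖ = 1)
    (hd : ∀ ω, |d * V ω| ≤ 1 / 8) (n : ℕ) (ω : ℤ → A) : ‖diskOrbit μ d V n ω‖ ≤ 1 := by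
  induction n with
  | zero => simp [diskOrbit]
  | succ n ih => exact norm_diskMap_le_one hμ ih (hd _)

theorem norm_diskOrbit_sub_le {μ : ℂ} {d β : ℝ} (hμ : ‖μ‖ = 1) (hr : 0 < r) (hr1 : r < 1)
    (hβ : β ≤ 1 / 8) (hβr : β ≤ (1 - r) / 16) (hd0 : 0 ≤ d) (hd1 : d ≤ 1 / 8)
    (hd : ∀ ω, |d * V ω| ≤ β) (hCv : 0 ≤ Cv)
    (hV : ∀ (i lo hi : ℤ) (d : ℕ) (ω ω' : ℤ → A), lo ≤ i - d → i + d ≤ hi →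
      AgreeOn lo hi ω ω' → |V (shiftn i ω) - V (shiftn i ω')| ≤ Cv * r ^ d)
    (n k : ℕ) {ω ω' : ℤ → A} (h : AgreeOn (-(n + k)) (n + k) ω ω') :
    ‖diskOrbit μ d V n ω - diskOrbit μ d V n ω'‖ ≤ 2 * Cv / (1 - r) * r ^ k := by
  have hd8 : ∀ ω, |d * V ω| ≤ 1 / 8 := fun ω => (hd ω).trans hβ
  have key : ∀ i l : ℕ, i + l = n + k →
      ‖diskOrbit μ d V i ω - diskOrbit μ d V i ω'‖ ≤ 2 * Cv / (1 - r) * r ^ l := by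
    intro i
    induction i with
    | zero =>
      intro l _
      have : 0 ≤ 2 * Cv / (1 - r) * r ^ l := by
        have : 0 < 1 - r := by linarith
        positivity
      simpa [diskOrbit] using this
    | succ i ih =>
      intro l hl
      have h1 := ih (l + 1) (by omega)
      have h2 := norm_diskMap_sub_le (v := d * orbitPotential V i ω)
        (v' := d * orbitPotential V i ω') hμ (norm_diskOrbit_le_one hμ hd8 i ω)
        (norm_diskOrbit_le_one hμ hd8 i ω') hβ (hd _) (hd _)
      have h3 := hV (i + 1) (-(n + k)) (n + k) l ω ω' (by omega) (by omega) h
      refine h2.trans ?_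
      have h4 : |d * orbitPotential V i ω - d * orbitPotential V i ω'| ≤ d * (Cv * r ^ l) := by
        rw [← mul_sub, abs_mul, abs_of_nonneg hd0]
        gcongr
        exact h3
      have hβ0 : 0 ≤ β := (abs_nonneg _).trans (hd ω)
      have h5 : 1 - (1 - r) / 4 ≤ (1 - 2 * β) ^ 2 := by nlinarith
      have h1r : 0 < 1 - r := by linarith
      rw [div_le_iff₀ (by nlinarith)]
      have h6 : 4 * (d * (Cv * r ^ l)) ≤ 1 / 2 * (Cv * r ^ l) := by
        have : 0 ≤ Cv * r ^ l := by positivity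
        nlinarith
      set X := 2 * Cv / (1 - r) * r ^ l with hX
      have hX' : Cv * r ^ l = X * (1 - r) / 2 := by
        rw [hX]
        field_simp
      have hX0 : 0 ≤ X := by positivity
      have h7 : 2 * Cv / (1 - r) * r ^ (l + 1) = X * r := by rw [hX]; ring
      have h8 : X * (1 - (1 - r) / 4) ≤ X * (1 - 2 * β) ^ 2 := by gcongr
      rw [h7] at h1
      rw [hX'] at h6 h4
      nlinarith
  exact key n k rfl

theorem norm_pow_sub_pow_le {x y : ℂ} (hx : ‖x‖ ≤ 1) (hy : ‖y‖ ≤ 1) (p : ℕ) :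
    ‖x ^ p - y ^ p‖ ≤ p * ‖x - y‖ := by
  induction p with
  | zero => simp
  | succ p ih =>
    have : x ^ (p + 1) - y ^ (p + 1) = (x ^ p - y ^ p) * x + y ^ p * (x - y) := by ring
    rw [this]
    refine (norm_add_le _ _).trans ?_
    rw [norm_mul, norm_mul, norm_pow]
    have h1 := mul_le_of_le_one_right (norm_nonneg (x ^ p - y ^ p)) hx
    have h2 := mul_le_of_le_one_left (norm_nonneg (x - y)) (pow_le_one₀ (norm_nonneg y) hy (n := p))
    push_cast
    linarith

end Orbit

/-- A bounded stationary driving process `Y` and a disc orbit `Z` driven by `d * Y`, with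
power-law decay of the correlations between the past and the future. -/
structure CorrelatedOrbit {Ω : Type*} [MeasurableSpace Ω] (P : Measure Ω) (Y : ℕ → Ω → ℝ)
    (Z : ℕ → Ω → ℂ) (c : ℕ → ℝ) (μ : ℂ) (d B K α : ℝ) : Prop where
  measY : ∀ n, Measurable (Y n)
  measZ : ∀ n, Measurable (Z n)
  absY : ∀ n ω, |Y n ω| ≤ B
  normZ : ∀ n ω, ‖Z n ω‖ ≤ 1
  norm_eq : ‖μ‖ = 1
  pos : 0 < d
  small : d * B ≤ 1 / 8
  step : ∀ n ω, Z (n + 1) ω = diskMap μ (d * Y n ω) (Z n ω)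
  mean : ∀ n, ∫ ω, Y n ω ∂P = 0
  corr : ∀ m j p, 1 ≤ j → p ≤ 4 →
    ‖∫ ω, (Y (m + j) ω : ℂ) * Z m ω ^ p ∂P‖ ≤ K * (j : ℝ) ^ (-α)
  corr_mul : ∀ m j p, 1 ≤ j → p ≤ 4 →
    ‖∫ ω, (Y (m + j) ω : ℂ) * ((Y m ω : ℂ) * Z m ω ^ p) ∂P‖ ≤ K * (j : ℝ) ^ (-α)
  corr_pair : ∀ m l j p, 1 ≤ l → p ≤ 4 →
    ‖∫ ω, ((Y (m + l + j) ω * Y (m + l) ω - c j : ℝ) : ℂ) * Z m ω ^ p ∂P‖ ≤ K * (l : ℝ) ^ (-α)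
  cov : ∀ m j, ∫ ω, Y (m + j) ω * Y m ω ∂P = c j

theorem exists_correlatedOrbit {A : Type*} [MeasurableSpace A] {P : Measure (ℤ → A)}
    [IsProbabilityMeasure P] (hinv : MeasurePreserving (shiftn 1) P P) {r : ℝ} (hr : 0 < r)
    (hr1 : r < 1) {V : (ℤ → A) → ℝ} (hVmeas : Measurable V) {B : ℝ} (hB1 : 1 ≤ B)
    (hVb : ∀ ω, |V ω| ≤ B) (hVql : QuasiLocal r V) (hVcent : ∫ ω, V ω ∂P = 0) {α : ℝ}
    (hα : 0 ≤ α) (hmix : PowerMixing P α) :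
    ∃ K ≥ 0, ∃ β > 0, ∀ (μ : ℂ) (d : ℝ), ‖μ‖ = 1 → 0 < d → d * B ≤ β →
      CorrelatedOrbit P (orbitPotential V) (diskOrbit μ d V)
        (fun j => ∫ ω, V ω * V (shiftn j ω) ∂P) μ d B K α := by
  obtain ⟨Cv, hCv0, hCv⟩ := hVql.exists_bound hr ⟨B, hVb⟩
  have h1r : 0 < 1 - r := by linarith
  set Kz := 4 * (2 * Cv / (1 - r)) with hKz
  have hKz0 : 0 ≤ Kz := by positivity
  set C := Kz + B * Kz + 2 * B * Cv with hC
  have hB0 : 0 < B := by linarith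
  have hC0 : 0 ≤ C := by positivity
  obtain ⟨K, hK0, hK⟩ := exists_decorrelation_complex (P := P) hmix hα hr hr1
    (M := B * B) (C := C) (by positivity) hC0
  have hBB : B ≤ B * B := by nlinarith
  have hβ0 : 0 < min (1 / 8) ((1 - r) / 16) := by
    apply lt_min <;> linarith
  refine ⟨K, hK0, min (1 / 8) ((1 - r) / 16), hβ0, fun μ d hμ hd hdB => ?_⟩
  set Y := orbitPotential V with hY
  set Z := diskOrbit μ d V with hZ
  set β := min (1 / 8) ((1 - r) / 16) with hβ
  have hβ1 : β ≤ 1 / 8 := min_le_left _ _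
  have hβ2 : β ≤ (1 - r) / 16 := min_le_right _ _
  have hdV : ∀ ω, |d * V ω| ≤ β := fun ω => by
    rw [abs_mul, abs_of_pos hd]
    refine le_trans ?_ hdB
    gcongr
    exact hVb ω
  have hd8 : d ≤ 1 / 8 := by nlinarith
  have measY : ∀ n, Measurable (Y n) := measurable_orbitPotential hVmeas
  have measZ : ∀ n, Measurable (Z n) := measurable_diskOrbit hVmeas μ d
  have absY : ∀ n ω, |Y n ω| ≤ B := fun n ω => hVb _
  have normZ : ∀ n ω, ‖Z n ω‖ ≤ 1 := norm_diskOrbit_le_one hμ fun ω => (hdV ω).trans hβ1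
  have normZp : ∀ n p ω, ‖Z n ω ^ p‖ ≤ 1 := fun n p ω => by
    rw [norm_pow]
    exact pow_le_one₀ (norm_nonneg _) (normZ n ω)
  have mean : ∀ n, ∫ ω, Y n ω ∂P = 0 := fun n => by
    have := integral_comp_shiftn hinv (n + 1) hVmeas
    rw [hVcent] at this
    push_cast at this
    exact this
  have hZsub : ∀ m k p : ℕ, p ≤ 4 → ∀ ω ω' : ℤ → A,
      AgreeOn (-((m + k : ℕ) + 1)) ((m : ℤ) + 1 + k) ω ω' →
      ‖Z m ω ^ p - Z m ω' ^ p‖ ≤ Kz * r ^ k := fun m k p hp ω ω' h => by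
    have h1 := norm_diskOrbit_sub_le hμ hr hr1 hβ1 hβ2 hd.le hd8 hdV hCv0 hCv m k (ω := ω)
      (ω' := ω') fun i hi hi' => h i (by omega) (by omega)
    have h2 := norm_pow_sub_pow_le (normZ m ω) (normZ m ω') p
    have h3 : (p : ℝ) ≤ 4 := by exact_mod_cast hp
    calc _ ≤ (p : ℝ) * ‖Z m ω - Z m ω'‖ := h2
      _ ≤ 4 * (2 * Cv / (1 - r) * r ^ k) := by gcongr
      _ = Kz * r ^ k := by rw [hKz]; ring
  have hBCv : 0 ≤ B * Cv := by positivity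
  have hBKz : 0 ≤ B * Kz := by positivity
  have pastZ : ∀ m p : ℕ, p ≤ 4 → PastLocal r C ((m : ℤ) + 1) fun ω => Z m ω ^ p :=
    fun m p hp k => ⟨_, fun ω ω' h => (hZsub m k p hp ω ω' h).trans (by
      gcongr
      linarith)⟩
  have hYsub : ∀ (m k : ℕ) (lo hi : ℤ) (ω ω' : ℤ → A), lo ≤ (m : ℤ) + 1 - k →
      (m : ℤ) + 1 + k ≤ hi → AgreeOn lo hi ω ω' → |Y m ω - Y m ω'| ≤ Cv * r ^ k :=
    fun m k lo hi ω ω' h1 h2 h => hCv _ lo hi k ω ω' h1 h2 h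
  have pastYZ : ∀ m p : ℕ, p ≤ 4 →
      PastLocal r C ((m : ℤ) + 1) fun ω => (Y m ω : ℂ) * Z m ω ^ p := fun m p hp k =>
    ⟨-((m + k : ℕ) + 1), fun ω ω' h => by
      have h1 := hZsub m k p hp ω ω' h
      have h2 := hYsub m k _ _ ω ω' (by omega) le_rfl h
      have h3 : (Y m ω : ℂ) * Z m ω ^ p - (Y m ω' : ℂ) * Z m ω' ^ p
        = (Y m ω : ℂ) * (Z m ω ^ p - Z m ω' ^ p) + ((Y m ω - Y m ω' : ℝ) : ℂ) * Z m ω' ^ p := by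
        push_cast
        ring
      rw [h3]
      refine (norm_add_le _ _).trans ?_
      rw [norm_mul, norm_mul, Complex.norm_real, Complex.norm_real]
      calc _ ≤ B * (Kz * r ^ k) + Cv * r ^ k * 1 := by
            gcongr
            · exact absY m ω
            · exact h2
            · exact normZp _ _ _
        _ = (B * Kz + Cv) * r ^ k := by ring
        _ ≤ C * r ^ k := by
          gcongr
          rw [hC]
          nlinarith⟩
  have futY : ∀ n : ℕ, FutureLocal r C ((n : ℤ) + 1) (Y n) := fun n k =>
    ⟨(n : ℤ) + 1 + k, fun ω ω' h => (hYsub n k _ _ ω ω' le_rfl le_rfl h).trans (by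
      gcongr
      rw [hC]
      nlinarith)⟩
  have futYY : ∀ n j : ℕ, FutureLocal r C ((n : ℤ) + 1) fun ω => Y (n + j) ω * Y n ω :=
    fun n j k => ⟨((n + j : ℕ) : ℤ) + 1 + k, fun ω ω' h => by
      have h1 := hYsub n k _ _ ω ω' le_rfl (by omega) h
      have h2 := hYsub (n + j) k _ _ ω ω' (by omega) le_rfl h
      have h3 : Y (n + j) ω * Y n ω - Y (n + j) ω' * Y n ω'
        = Y (n + j) ω * (Y n ω - Y n ω') + (Y (n + j) ω - Y (n + j) ω') * Y n ω' := by ring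
      rw [h3]
      refine (norm_add_le _ _).trans ?_
      rw [norm_mul, norm_mul]
      simp only [Real.norm_eq_abs]
      calc _ ≤ B * (Cv * r ^ k) + Cv * r ^ k * B := by
            gcongr
            · exact absY _ ω
            · exact absY _ ω'
        _ = (2 * B * Cv) * r ^ k := by ring
        _ ≤ C * r ^ k := by
          gcongr
          rw [hC]
          linarith⟩
  have cov : ∀ m j : ℕ, ∫ ω, Y (m + j) ω * Y m ω ∂P = ∫ ω, V ω * V (shiftn j ω) ∂P :=
    fun m j => integral_orbitPotential_mul hinv hVmeas m j
  have bYY : ∀ m n ω, |Y m ω * Y n ω| ≤ B * B := fun m n ω => by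
    rw [abs_mul]
    exact mul_le_mul (absY _ _) (absY _ _) (abs_nonneg _) hB0.le
  have bYZ : ∀ m p ω, ‖(Y m ω : ℂ) * Z m ω ^ p‖ ≤ B * B := fun m p ω => by
    rw [norm_mul, Complex.norm_real]
    exact mul_le_mul (absY _ _) ((normZp m p ω).trans hB1) (norm_nonneg _) hB0.le
  refine ⟨measY, measZ, absY, normZ, hμ, hd, hdB.trans hβ1, fun n ω => rfl, mean, ?_, ?_, ?_, cov⟩
  · intro m j p hj hp
    have h := hK (m + 1) j hj (fun ω => Z m ω ^ p) (Y (m + j)) ((measZ m).pow_const p) (measY _)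
      (fun ω => (normZp m p ω).trans (by nlinarith)) (fun ω => (absY _ ω).trans hBB) (pastZ m p hp)
      (by have := futY (m + j)
          push_cast at this
          rwa [show (m : ℤ) + 1 + j = m + j + 1 by ring])
    rwa [mean, Complex.ofReal_zero, zero_mul, sub_zero] at h
  · intro m j p hj hp
    have h := hK (m + 1) j hj (fun ω => (Y m ω : ℂ) * Z m ω ^ p) (Y (m + j))
      ((Complex.measurable_ofReal.comp (measY m)).mul ((measZ m).pow_const p)) (measY _)
      (bYZ m p) (fun ω => (absY _ ω).trans hBB) (pastYZ m p hp)
      (by have := futY (m + j)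
          push_cast at this
          rwa [show (m : ℤ) + 1 + j = m + j + 1 by ring])
    rwa [mean, Complex.ofReal_zero, zero_mul, sub_zero] at h
  · intro m l j p hl hp
    have h := hK (m + 1) l hl (fun ω => Z m ω ^ p) (fun ω => Y (m + l + j) ω * Y (m + l) ω)
      ((measZ m).pow_const p) ((measY _).mul (measY _))
      (fun ω => (normZp m p ω).trans (by nlinarith)) (bYY _ _) (pastZ m p hp)
      (by have := futYY (m + l) j
          push_cast at this
          rwa [show (m : ℤ) + 1 + l = m + l + 1 by ring])
    rw [cov] at h
    refine le_of_eq_of_le (congrArg norm ?_) h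
    rw [← integral_const_mul, ← integral_sub]
    · refine integral_congr_ae (ae_of_all _ fun ω => ?_)
      push_cast
      ring
    · refine integrable_of_measurable_of_norm_le (M := B * B * 1)
        ((Complex.measurable_ofReal.comp ((measY _).mul (measY _))).mul
          ((measZ m).pow_const p)) fun ω => ?_
      rw [norm_mul, Complex.norm_real]
      exact mul_le_mul (bYY _ _ ω) (normZp m p ω) (norm_nonneg _) (by positivity)
    · exact (integrable_of_measurable_of_norm_le ((measZ m).pow_const p) (normZp m p)).const_mul _

/-! ### Averaging along a correlated orbit -/

theorem CesaroBound.congr_fun {s t : ℕ → ℂ} {e : ℝ} (hs : CesaroBound s e)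
    (h : ∀ n, t n = s n) : CesaroBound t e := by
  rwa [funext h]

theorem CesaroBound.re {s : ℕ → ℂ} {e : ℝ} (hs : CesaroBound s e) :
    CesaroBound (fun n => ((s n).re : ℂ)) e := by
  obtain ⟨K, hK⟩ := hs
  refine ⟨K, fun N => le_trans ?_ (hK N)⟩
  rw [← Complex.ofReal_sum, Complex.norm_real, ← Complex.re_sum]
  exact Complex.abs_re_le_norm _

theorem integrable_ofReal_mul {Ω : Type*} [MeasurableSpace Ω] {P : Measure Ω}
    [IsProbabilityMeasure P] {H : Ω → ℝ} {F : Ω → ℂ} (hH : Measurable H) (hF : Measurable F)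
    {M N : ℝ} (hHb : ∀ ω, |H ω| ≤ M) (hFb : ∀ ω, ‖F ω‖ ≤ N) :
    Integrable (fun ω => (H ω : ℂ) * F ω) P := by
  refine integrable_of_measurable_of_norm_le (M := M * N)
    ((Complex.measurable_ofReal.comp hH).mul hF) fun ω => ?_
  rw [norm_mul, Complex.norm_real]
  exact mul_le_mul (hHb ω) (hFb ω) (norm_nonneg _) ((abs_nonneg _).trans (hHb ω))

theorem sum_range_succ_rpow_le {s : ℝ} (hs : 1 < s) (L : ℕ) :
    ∑ i ∈ Finset.range L, ((i + 1 : ℕ) : ℝ) ^ (-s) ≤ ∑' n : ℕ, (n : ℝ) ^ (-s) := by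
  have hsum : Summable fun n : ℕ => (n : ℝ) ^ (-s) := Real.summable_nat_rpow.2 (by linarith)
  calc _ ≤ ∑ i ∈ Finset.range (L + 1), (i : ℝ) ^ (-s) := by
        rw [Finset.sum_range_succ']
        have : 0 ≤ ((0 : ℕ) : ℝ) ^ (-s) := by positivity
        linarith
    _ ≤ _ := hsum.sum_le_tsum _ fun i _ => by positivity

theorem sum_range_sub_rpow_le {s : ℝ} (hs : 1 < s) (L : ℕ) :
    ∑ i ∈ Finset.range L, ((L - i : ℕ) : ℝ) ^ (-s) ≤ ∑' n : ℕ, (n : ℝ) ^ (-s) := by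
  refine le_trans (le_of_eq ?_) (sum_range_succ_rpow_le hs L)
  rw [← Finset.sum_range_reflect]
  refine Finset.sum_congr rfl fun i hi => ?_
  have := Finset.mem_range.1 hi
  congr 2
  omega

theorem norm_one_sub_pow_le {μ : ℂ} (hμ : ‖μ‖ = 1) (j : ℕ) : ‖1 - μ ^ j‖ ≤ j * ‖1 - μ‖ := by
  have := norm_pow_sub_pow_le (x := 1) (y := μ) (by simp) hμ.le j
  rwa [one_pow] at this

namespace CorrelatedOrbit

variable {Ω : Type*} [MeasurableSpace Ω] {P : Measure Ω}
  {Y : ℕ → Ω → ℝ} {Z : ℕ → Ω → ℂ} {c : ℕ → ℝ} {μ : ℂ} {d B K α : ℝ}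

theorem norm_pow_le (h : CorrelatedOrbit P Y Z c μ d B K α) (n p : ℕ) (ω : Ω) :
    ‖Z n ω ^ p‖ ≤ 1 := by
  rw [norm_pow]
  exact pow_le_one₀ (norm_nonneg _) (h.normZ n ω)

theorem abs_drive_le (h : CorrelatedOrbit P Y Z c μ d B K α) (n : ℕ) (ω : Ω) :
    |d * Y n ω| ≤ d * B := by
  rw [abs_mul, abs_of_pos h.pos]
  exact mul_le_mul_of_nonneg_left (h.absY n ω) h.pos.le

theorem norm_one_add_sq_le (h : CorrelatedOrbit P Y Z c μ d B K α) (n : ℕ) (ω : Ω) :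
    ‖(1 + Z n ω) ^ 2‖ ≤ 4 := by
  rw [norm_pow]
  nlinarith [norm_one_add_le_two (h.normZ n ω), norm_nonneg (1 + Z n ω)]

variable [IsProbabilityMeasure P]

theorem nonneg (h : CorrelatedOrbit P Y Z c μ d B K α) : 0 ≤ B := by
  obtain ⟨ω⟩ := P.nonempty_of_neZero
  exact (abs_nonneg _).trans (h.absY 0 ω)

theorem norm_mul_pow_le (h : CorrelatedOrbit P Y Z c μ d B K α) (n p : ℕ) (ω : Ω) :
    ‖(Y n ω : ℂ) * Z n ω ^ p‖ ≤ B := by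
  rw [norm_mul, Complex.norm_real]
  exact (mul_le_mul (h.absY n ω) (h.norm_pow_le n p ω) (norm_nonneg _) h.nonneg).trans
    (mul_one B).le

theorem norm_drift_le (h : CorrelatedOrbit P Y Z c μ d B K α) (n q : ℕ) (ω : Ω) :
    ‖(Y n ω : ℂ) * (Z n ω ^ q * (1 + Z n ω) ^ 2)‖ ≤ 4 * B := by
  rw [norm_mul, norm_mul, Complex.norm_real]
  calc _ ≤ B * (1 * 4) := by
        gcongr
        · exact h.nonneg
        · exact h.absY n ω
        · exact h.norm_pow_le n q ω
        · exact h.norm_one_add_sq_le n ω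
    _ = 4 * B := by ring

theorem integrable_pow (h : CorrelatedOrbit P Y Z c μ d B K α) {H : Ω → ℝ} (hH : Measurable H)
    {M : ℝ} (hM : ∀ ω, |H ω| ≤ M) (n p : ℕ) :
    Integrable (fun ω => (H ω : ℂ) * Z n ω ^ p) P :=
  integrable_ofReal_mul hH ((h.measZ n).pow_const p) hM (h.norm_pow_le n p)

theorem integrable_mul_pow (h : CorrelatedOrbit P Y Z c μ d B K α) {H : Ω → ℝ}
    (hH : Measurable H) {M : ℝ} (hM : ∀ ω, |H ω| ≤ M) (n p : ℕ) :
    Integrable (fun ω => (H ω : ℂ) * ((Y n ω : ℂ) * Z n ω ^ p)) P :=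
  integrable_ofReal_mul hH
    ((Complex.measurable_ofReal.comp (h.measY n)).mul ((h.measZ n).pow_const p)) hM
    (h.norm_mul_pow_le n p)

theorem integrable_drift (h : CorrelatedOrbit P Y Z c μ d B K α) {H : Ω → ℝ}
    (hH : Measurable H) {M : ℝ} (hM : ∀ ω, |H ω| ≤ M) (n q : ℕ) :
    Integrable (fun ω => (H ω : ℂ) * ((Y n ω : ℂ) * (Z n ω ^ q * (1 + Z n ω) ^ 2))) P := by
  have h1 := h.measZ n
  have h2 := h.measY n
  exact integrable_ofReal_mul hH (by fun_prop) hM (h.norm_drift_le n q)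

/-- One step of the orbit, tested against a bounded observable. -/
theorem norm_integral_step_le (h : CorrelatedOrbit P Y Z c μ d B K α) {H : Ω → ℝ}
    (hH : Measurable H) {M : ℝ} (hM : ∀ ω, |H ω| ≤ M) (n : ℕ) {q : ℕ} (hq : q ≤ 2) :
    ‖∫ ω, (H ω : ℂ) * Z (n + 1) ω ^ (q + 1) ∂P
      - μ ^ (q + 1) * (∫ ω, (H ω : ℂ) * Z n ω ^ (q + 1) ∂P + -Complex.I * (q + 1) * d *
        ∫ ω, (H ω : ℂ) * ((Y n ω : ℂ) * (Z n ω ^ q * (1 + Z n ω) ^ 2)) ∂P)‖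
      ≤ M * (120 * (d * B) ^ 2) := by
  have i1 := h.integrable_pow hH hM (n + 1) (q + 1)
  have i2 := h.integrable_pow hH hM n (q + 1)
  have i3 := h.integrable_drift hH hM n q
  have i4 : Integrable (fun ω => (H ω : ℂ) * Z n ω ^ (q + 1) + -Complex.I * (q + 1) * d *
      ((H ω : ℂ) * ((Y n ω : ℂ) * (Z n ω ^ q * (1 + Z n ω) ^ 2)))) P := i2.add (i3.const_mul _)
  rw [← integral_const_mul, ← integral_add i2 (i3.const_mul _), ← integral_const_mul,
    ← integral_sub i1 (i4.const_mul _)]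
  refine norm_integral_le_of_forall_norm_le fun ω => ?_
  have hv := h.abs_drive_le n ω
  have h1 := norm_diskMap_pow_taylor_le h.norm_eq (h.normZ n ω) (hv.trans h.small) hq
  rw [← h.step] at h1
  have h2 : (H ω : ℂ) * Z (n + 1) ω ^ (q + 1)
      - μ ^ (q + 1) * ((H ω : ℂ) * Z n ω ^ (q + 1) + -Complex.I * (q + 1) * d *
        ((H ω : ℂ) * ((Y n ω : ℂ) * (Z n ω ^ q * (1 + Z n ω) ^ 2))))
      = (H ω : ℂ) * (Z (n + 1) ω ^ (q + 1) - μ ^ (q + 1) * (Z n ω ^ (q + 1) +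
        -Complex.I * (q + 1) * ((d * Y n ω : ℝ) : ℂ) * (Z n ω ^ q * (1 + Z n ω) ^ 2))) := by
    push_cast
    ring
  rw [h2, norm_mul, Complex.norm_real]
  have h3 : (d * Y n ω) ^ 2 ≤ (d * B) ^ 2 := by
    rw [← sq_abs]
    gcongr
  have hM0 : 0 ≤ M := (abs_nonneg _).trans (hM ω)
  exact mul_le_mul (hM ω) (h1.trans (by linarith)) (norm_nonneg _) hM0

theorem integral_drift_eq (h : CorrelatedOrbit P Y Z c μ d B K α) {H : Ω → ℝ}
    (hH : Measurable H) {M : ℝ} (hM : ∀ ω, |H ω| ≤ M) (n q : ℕ) :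
    ∫ ω, (H ω : ℂ) * ((Y n ω : ℂ) * (Z n ω ^ q * (1 + Z n ω) ^ 2)) ∂P
      = ∫ ω, (H ω : ℂ) * ((Y n ω : ℂ) * Z n ω ^ q) ∂P
        + 2 * ∫ ω, (H ω : ℂ) * ((Y n ω : ℂ) * Z n ω ^ (q + 1)) ∂P
        + ∫ ω, (H ω : ℂ) * ((Y n ω : ℂ) * Z n ω ^ (q + 2)) ∂P := by
  have i1 := h.integrable_mul_pow hH hM n q
  have i2 := h.integrable_mul_pow hH hM n (q + 1)
  have i3 := h.integrable_mul_pow hH hM n (q + 2)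
  have i4 : Integrable (fun ω => (H ω : ℂ) * ((Y n ω : ℂ) * Z n ω ^ q)
      + 2 * ((H ω : ℂ) * ((Y n ω : ℂ) * Z n ω ^ (q + 1)))) P := i1.add (i2.const_mul _)
  rw [← integral_const_mul, ← integral_add i1 (i2.const_mul _), ← integral_add i4 i3]
  refine integral_congr_ae (ae_of_all _ fun ω => ?_)
  ring

theorem norm_integral_drift_le (h : CorrelatedOrbit P Y Z c μ d B K α) (m : ℕ) {j q : ℕ}
    (hj : 1 ≤ j) (hq : q ≤ 2) :
    ‖∫ ω, (Y (m + j) ω : ℂ) * ((Y m ω : ℂ) * (Z m ω ^ q * (1 + Z m ω) ^ 2)) ∂P‖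
      ≤ 4 * (K * (j : ℝ) ^ (-α)) := by
  rw [h.integral_drift_eq (h.measY _) (h.absY _)]
  have h1 := h.corr_mul m j q hj (by omega)
  have h2 := h.corr_mul m j (q + 1) hj (by omega)
  have h3 := h.corr_mul m j (q + 2) hj (by omega)
  refine norm_add₃_le.trans ?_
  rw [norm_mul, Complex.norm_ofNat]
  linarith

/-- The potential is decorrelated from the orbit, up to first order in the coupling. -/
theorem norm_integral_mul_pow_le (h : CorrelatedOrbit P Y Z c μ d B K α) (hK : 0 ≤ K)
    (hα : 1 < α) (m : ℕ) {L p : ℕ} (hL : 1 ≤ L) (hp : p ≤ 3) :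
    ‖∫ ω, (Y (m + L) ω : ℂ) * Z (m + L) ω ^ p ∂P‖
      ≤ K * (L : ℝ) ^ (-α) + 12 * d * K * ∑' n : ℕ, (n : ℝ) ^ (-α)
        + L * (B * (120 * (d * B) ^ 2)) := by
  have hd := h.pos
  have hB := h.nonneg
  rcases Nat.eq_zero_or_pos p with rfl | hp0
  · have h1 : ∫ ω, (Y (m + L) ω : ℂ) * Z (m + L) ω ^ 0 ∂P = 0 := by
      simp only [pow_zero, mul_one]
      rw [integral_complex_ofReal, h.mean, Complex.ofReal_zero]
    rw [h1, norm_zero]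
    have : 0 ≤ ∑' n : ℕ, (n : ℝ) ^ (-α) := tsum_nonneg fun n => by positivity
    positivity
  · obtain ⟨q, rfl⟩ : ∃ q, p = q + 1 := ⟨p - 1, by omega⟩
    have hu := norm_sub_unrolled_le (a := fun i => ∫ ω, (Y (m + L) ω : ℂ) * Z (m + i) ω ^ (q + 1) ∂P)
      (b := fun i => -Complex.I * (q + 1) * d * ∫ ω, (Y (m + L) ω : ℂ) *
        ((Y (m + i) ω : ℂ) * (Z (m + i) ω ^ q * (1 + Z (m + i) ω) ^ 2)) ∂P)
      (w := μ ^ (q + 1)) (e := fun _ => B * (120 * (d * B) ^ 2))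
      (by rw [norm_pow, h.norm_eq, one_pow]) L
      (fun i _ => h.norm_integral_step_le (h.measY _) (h.absY _) (m + i) (by omega))
    have h0 := h.corr m L (q + 1) hL (by omega)
    have hs := norm_sum_le_of_le (Finset.range L) (f := fun i => (μ ^ (q + 1)) ^ (L - i) *
      (-Complex.I * (q + 1) * d * ∫ ω, (Y (m + L) ω : ℂ) *
        ((Y (m + i) ω : ℂ) * (Z (m + i) ω ^ q * (1 + Z (m + i) ω) ^ 2)) ∂P))
      (n := fun i => 12 * d * K * ((L - i : ℕ) : ℝ) ^ (-α)) (fun i hi => by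
        have hi' := Finset.mem_range.1 hi
        have h1 := h.norm_integral_drift_le (m + i) (j := L - i) (q := q) (by omega) (by omega)
        rw [show m + i + (L - i) = m + L by omega] at h1
        have h2 : ‖(q : ℂ) + 1‖ ≤ 3 := by
          rw [← Nat.cast_one, ← Nat.cast_add, Complex.norm_natCast]
          exact_mod_cast hp
        rw [norm_mul, norm_pow, norm_pow, h.norm_eq, one_pow, one_pow, one_mul, norm_mul, norm_mul,
          norm_mul, norm_neg, Complex.norm_I, one_mul, Complex.norm_real, Real.norm_eq_abs,
          abs_of_pos hd]
        calc _ ≤ 3 * d * (4 * (K * ((L - i : ℕ) : ℝ) ^ (-α))) := by gcongr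
          _ = _ := by ring)
    rw [← Finset.mul_sum] at hs
    have ht := mul_le_mul_of_nonneg_left (sum_range_sub_rpow_le hα L)
      (by positivity : 0 ≤ 12 * d * K)
    simp only [Finset.sum_const, Finset.card_range, nsmul_eq_mul] at hu
    set S := ∑ i ∈ Finset.range L, (μ ^ (q + 1)) ^ (L - i) *
      (-Complex.I * (q + 1) * d * ∫ ω, (Y (m + L) ω : ℂ) *
        ((Y (m + i) ω : ℂ) * (Z (m + i) ω ^ q * (1 + Z (m + i) ω) ^ 2)) ∂P)
    set x := ∫ ω, (Y (m + L) ω : ℂ) * Z (m + L) ω ^ (q + 1) ∂P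
    set y := ∫ ω, (Y (m + L) ω : ℂ) * Z (m + 0) ω ^ (q + 1) ∂P
    have e1 : x = (x - (μ ^ (q + 1)) ^ L * y - S) + (μ ^ (q + 1)) ^ L * y + S := by ring
    rw [e1]
    refine norm_add₃_le.trans ?_
    rw [norm_mul, norm_pow, norm_pow, h.norm_eq, one_pow, one_pow, one_mul]
    have hy : ‖y‖ ≤ K * (L : ℝ) ^ (-α) := h0
    linarith

theorem cesaroBound_pow (h : CorrelatedOrbit P Y Z c μ d B K α) {θ : ℝ} {L : ℕ}
    (hθ : ∀ m p, p ≤ 3 → ‖∫ ω, (Y (m + L) ω : ℂ) * Z (m + L) ω ^ p ∂P‖ ≤ θ) {q : ℕ} (hq : q ≤ 1)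
    {σ : ℝ} (hσ : 0 < σ) (hμ : σ ≤ ‖1 - μ ^ (q + 1)‖) :
    CesaroBound (fun n => ∫ ω, Z n ω ^ (q + 1) ∂P) ((120 * (d * B) ^ 2 + 8 * d * θ) / σ) := by
  have hd := h.pos
  have hB := h.nonneg
  have hθ0 : 0 ≤ θ := (norm_nonneg _).trans (hθ 0 0 (by omega))
  have hne : μ ^ (q + 1) ≠ 1 := fun he => by
    rw [he, sub_self, norm_zero] at hμ
    linarith
  refine CesaroBound.of_shift (by positivity) L ?_
  refine (CesaroBound.of_recursion (e := 120 * (d * B) ^ 2 + 8 * d * θ) hne (M := 1)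
    (fun n => norm_integral_le_of_forall_norm_le (h.norm_pow_le _ _)) fun n => ?_).mono ?_
  · have h1 := h.norm_integral_step_le (H := fun _ => 1) measurable_const (M := 1) (by simp) (n + L)
      (q := q) (by omega)
    have h2 := h.integral_drift_eq (H := fun _ => 1) measurable_const (M := 1) (by simp) (n + L) q
    simp only [Complex.ofReal_one, one_mul] at h1 h2
    rw [show n + 1 + L = n + L + 1 by ring]
    set D := ∫ ω, (Y (n + L) ω : ℂ) * (Z (n + L) ω ^ q * (1 + Z (n + L) ω) ^ 2) ∂P
    have hD : ‖D‖ ≤ 4 * θ := by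
      rw [h2]
      refine norm_add₃_le.trans ?_
      rw [norm_mul, Complex.norm_ofNat]
      linarith [hθ n q (by omega), hθ n (q + 1) (by omega), hθ n (q + 2) (by omega)]
    set x := ∫ ω, Z (n + L + 1) ω ^ (q + 1) ∂P
    set y := ∫ ω, Z (n + L) ω ^ (q + 1) ∂P
    have e1 : x - μ ^ (q + 1) * y = (x - μ ^ (q + 1) * (y + -Complex.I * (q + 1) * d * D))
        + μ ^ (q + 1) * (-Complex.I * (q + 1) * d * D) := by ring
    rw [e1]
    refine (norm_add_le _ _).trans (add_le_add h1 ?_)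
    have h3 : ‖(q : ℂ) + 1‖ ≤ 2 := by
      rw [← Nat.cast_one, ← Nat.cast_add, Complex.norm_natCast]
      exact_mod_cast Nat.succ_le_succ hq
    rw [norm_mul, norm_pow, h.norm_eq, one_pow, one_mul, norm_mul, norm_mul,
      norm_mul, norm_neg, Complex.norm_I, one_mul, Complex.norm_real, Real.norm_eq_abs,
      abs_of_pos hd]
    calc _ ≤ 2 * d * (4 * θ) := by gcongr
      _ = _ := by ring
  · gcongr

theorem integral_one_add_sq (h : CorrelatedOrbit P Y Z c μ d B K α) (n : ℕ) :
    ∫ ω, (1 + Z n ω) ^ 2 ∂P = 1 + 2 * ∫ ω, Z n ω ^ (0 + 1) ∂P + ∫ ω, Z n ω ^ (1 + 1) ∂P := by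
  have i1 := integrable_of_measurable_of_norm_le (P := P) ((h.measZ n).pow_const (0 + 1))
    (h.norm_pow_le n (0 + 1))
  have i2 := integrable_of_measurable_of_norm_le (P := P) ((h.measZ n).pow_const (1 + 1))
    (h.norm_pow_le n (1 + 1))
  have i0 : Integrable (fun _ : Ω => (1 : ℂ)) P := integrable_const 1
  have h1 : (1 : ℂ) = ∫ _ : Ω, (1 : ℂ) ∂P := by simp
  conv_rhs => rw [h1]
  have i3 : Integrable (fun ω => 1 + 2 * Z n ω ^ (0 + 1)) P := i0.add (i1.const_mul _)
  rw [← integral_const_mul, ← integral_add i0 (i1.const_mul _), ← integral_add i3 i2]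
  refine integral_congr_ae (ae_of_all _ fun ω => ?_)
  ring

theorem cesaroBound_one_add_sq (h : CorrelatedOrbit P Y Z c μ d B K α) {θ : ℝ} {L : ℕ}
    (hθ : ∀ m p, p ≤ 3 → ‖∫ ω, (Y (m + L) ω : ℂ) * Z (m + L) ω ^ p ∂P‖ ≤ θ)
    {σ : ℝ} (hσ : 0 < σ) (hμ : σ ≤ ‖1 - μ‖) (hμ2 : σ ≤ ‖1 - μ ^ 2‖) :
    CesaroBound (fun n => ∫ ω, (1 + Z n ω) ^ 2 ∂P - 1)
      (3 * ((120 * (d * B) ^ 2 + 8 * d * θ) / σ)) := by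
  have h1 := h.cesaroBound_pow hθ (q := 0) (by omega) hσ (by simpa using hμ)
  have h2 := h.cesaroBound_pow hθ (q := 1) le_rfl hσ (by simpa using hμ2)
  have h3 := (h1.const_mul 2).add h2
  rw [Complex.norm_ofNat] at h3
  refine (h3.mono (le_of_eq (by ring))).congr_fun ?_
  intro n
  rw [h.integral_one_add_sq]
  ring

end CorrelatedOrbit

theorem norm_sub_sum_le_of_unrolled {μ x y : ℂ} {F G C : ℕ → ℂ} {d e e' e'' : ℝ} {L : ℕ}
    (hμ : ‖μ‖ = 1) (hd : 0 ≤ d) (hy : ‖y‖ ≤ e)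
    (hx : ‖x - μ ^ L * y - ∑ i ∈ Finset.range L, μ ^ (L - i) * (-Complex.I * d * G i)‖ ≤ e')
    (hG : ∀ i < L, ‖G i - C (L - i) * F i‖ ≤ e'') :
    ‖Complex.I * d * x - d ^ 2 * ∑ i ∈ Finset.range L, μ ^ (L - i) * (C (L - i) * F i)‖
      ≤ d * (e + e') + d ^ 2 * (L * e'') := by
  have hs := norm_sum_le_of_le (Finset.range L)
    (f := fun i => μ ^ (L - i) * (G i - C (L - i) * F i)) (n := fun _ => e'') fun i hi => by
      rw [norm_mul, norm_pow, hμ, one_pow, one_mul]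
      exact hG i (Finset.mem_range.1 hi)
  simp only [Finset.sum_const, Finset.card_range, nsmul_eq_mul] at hs
  have e2 : ∑ i ∈ Finset.range L, μ ^ (L - i) * (-Complex.I * d * G i)
      = -Complex.I * d * ∑ i ∈ Finset.range L, μ ^ (L - i) * G i := by
    rw [Finset.mul_sum]
    exact Finset.sum_congr rfl fun i _ => by ring
  have e3 : ∑ i ∈ Finset.range L, μ ^ (L - i) * (G i - C (L - i) * F i)
      = ∑ i ∈ Finset.range L, μ ^ (L - i) * G i
        - ∑ i ∈ Finset.range L, μ ^ (L - i) * (C (L - i) * F i) := by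
    simp only [mul_sub, Finset.sum_sub_distrib]
  rw [e2] at hx
  rw [e3] at hs
  set S := ∑ i ∈ Finset.range L, μ ^ (L - i) * G i
  set T := ∑ i ∈ Finset.range L, μ ^ (L - i) * (C (L - i) * F i)
  have e1 : Complex.I * d * x - d ^ 2 * T
      = Complex.I * d * (x - μ ^ L * y - -Complex.I * d * S)
        + Complex.I * d * (μ ^ L * y) + d ^ 2 * (S - T) := by
    linear_combination (-(d : ℂ) ^ 2 * S) * Complex.I_sq
  rw [e1]
  refine norm_add₃_le.trans ?_
  have n1 : ‖Complex.I * (d : ℂ)‖ = d := by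
    rw [norm_mul, Complex.norm_I, one_mul, Complex.norm_real, Real.norm_eq_abs, abs_of_nonneg hd]
  have n2 : ‖(d : ℂ) ^ 2‖ = d ^ 2 := by
    rw [norm_pow, Complex.norm_real, Real.norm_eq_abs, abs_of_nonneg hd]
  rw [norm_mul, n1, norm_mul, n1, norm_mul, norm_pow, hμ, one_pow, one_mul, norm_mul, n2]
  have g1 := mul_le_mul_of_nonneg_left hx hd
  have g2 := mul_le_mul_of_nonneg_left hy hd
  have g3 := mul_le_mul_of_nonneg_left hs (sq_nonneg d)
  linarith

namespace CorrelatedOrbit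

variable {Ω : Type*} [MeasurableSpace Ω] {P : Measure Ω}
  {Y : ℕ → Ω → ℝ} {Z : ℕ → Ω → ℂ} {c : ℕ → ℝ} {μ : ℂ} {d B K α : ℝ}

theorem abs_cov_le (h : CorrelatedOrbit P Y Z c μ d B K α) {j : ℕ} (hj : 1 ≤ j) :
    |c j| ≤ K * (j : ℝ) ^ (-α) := by
  have h1 := h.corr_mul 0 j 0 hj (by omega)
  simp only [pow_zero, mul_one, ← Complex.ofReal_mul] at h1
  rwa [integral_complex_ofReal, h.cov, Complex.norm_real] at h1

theorem sum_abs_cov_le (h : CorrelatedOrbit P Y Z c μ d B K α) (hK : 0 ≤ K) (hα : 1 < α)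
    (L : ℕ) :
    ∑ i ∈ Finset.range L, |c (L - i)| ≤ K * ∑' n : ℕ, (n : ℝ) ^ (-α) := by
  have h1 := mul_le_mul_of_nonneg_left (sum_range_sub_rpow_le hα L) hK
  refine le_trans ?_ h1
  rw [Finset.mul_sum]
  exact Finset.sum_le_sum fun i hi => h.abs_cov_le (by have := Finset.mem_range.1 hi; omega)

variable [IsProbabilityMeasure P]

/-- One step of the orbit is a rotation, up to an error of the order of the coupling. -/
theorem norm_integral_rotation_le (h : CorrelatedOrbit P Y Z c μ d B K α) {H : Ω → ℝ}
    (hH : Measurable H) {M : ℝ} (hM : ∀ ω, |H ω| ≤ M) (n : ℕ) {q : ℕ} (hq : q ≤ 1) :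
    ‖∫ ω, (H ω : ℂ) * Z (n + 1) ω ^ (q + 1) ∂P
      - μ ^ (q + 1) * ∫ ω, (H ω : ℂ) * Z n ω ^ (q + 1) ∂P‖ ≤ M * (23 * (d * B)) := by
  have hd := h.pos
  have hB := h.nonneg
  have hM0 : 0 ≤ M := by
    obtain ⟨ω⟩ := P.nonempty_of_neZero
    exact (abs_nonneg _).trans (hM ω)
  have h1 := h.norm_integral_step_le hH hM n (q := q) (by omega)
  have h2 : ‖∫ ω, (H ω : ℂ) * ((Y n ω : ℂ) * (Z n ω ^ q * (1 + Z n ω) ^ 2)) ∂P‖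
      ≤ M * (4 * B) := norm_integral_le_of_forall_norm_le fun ω => by
    rw [norm_mul, Complex.norm_real]
    exact mul_le_mul (hM ω) (h.norm_drift_le n q ω) (norm_nonneg _) hM0
  set x := ∫ ω, (H ω : ℂ) * Z (n + 1) ω ^ (q + 1) ∂P
  set y := ∫ ω, (H ω : ℂ) * Z n ω ^ (q + 1) ∂P
  set D := ∫ ω, (H ω : ℂ) * ((Y n ω : ℂ) * (Z n ω ^ q * (1 + Z n ω) ^ 2)) ∂P
  have e1 : x - μ ^ (q + 1) * y = (x - μ ^ (q + 1) * (y + -Complex.I * (q + 1) * d * D))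
      + μ ^ (q + 1) * (-Complex.I * (q + 1) * d * D) := by ring
  have h3 : ‖(q : ℂ) + 1‖ ≤ 2 := by
    rw [← Nat.cast_one, ← Nat.cast_add, Complex.norm_natCast]
    exact_mod_cast Nat.succ_le_succ hq
  rw [e1]
  refine (norm_add_le _ _).trans ((add_le_add_left h1 _).trans ?_)
  rw [norm_mul, norm_pow, h.norm_eq, one_pow, one_mul, norm_mul, norm_mul,
    norm_mul, norm_neg, Complex.norm_I, one_mul, Complex.norm_real, Real.norm_eq_abs,
    abs_of_pos hd]
  have h4 : ‖(q : ℂ) + 1‖ * d * ‖D‖ ≤ 2 * d * (M * (4 * B)) := by gcongr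
  have h5 : M * (d * B * (d * B)) ≤ M * (d * B * (1 / 8)) := by
    have := h.small
    gcongr
  linarith

theorem abs_cov_le_sq (h : CorrelatedOrbit P Y Z c μ d B K α) (j : ℕ) : |c j| ≤ B ^ 2 := by
  rw [← h.cov 0 j, ← Real.norm_eq_abs]
  refine norm_integral_le_of_forall_norm_le fun ω => ?_
  rw [norm_mul, sq]
  exact mul_le_mul (h.absY _ ω) (h.absY _ ω) (norm_nonneg _) h.nonneg

theorem norm_integral_pair_mul_pow_le (h : CorrelatedOrbit P Y Z c μ d B K α) (m j : ℕ)
    {L q : ℕ} (hL : 1 ≤ L) (hq : q ≤ 1) :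
    ‖∫ ω, ((Y (m + L + j) ω * Y (m + L) ω - c j : ℝ) : ℂ) * Z (m + L) ω ^ (q + 1) ∂P‖
      ≤ K * (L : ℝ) ^ (-α) + 46 * L * B ^ 3 * d := by
  have hH : Measurable fun ω => Y (m + L + j) ω * Y (m + L) ω - c j :=
    ((h.measY _).mul (h.measY _)).sub_const _
  have hM : ∀ ω, |Y (m + L + j) ω * Y (m + L) ω - c j| ≤ 2 * B ^ 2 := fun ω => by
    have h1 := abs_sub (Y (m + L + j) ω * Y (m + L) ω) (c j)
    rw [abs_mul] at h1
    have h2 := mul_le_mul (h.absY (m + L + j) ω) (h.absY (m + L) ω) (abs_nonneg _) h.nonneg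
    linarith [h.abs_cov_le_sq j]
  have hu := norm_sub_unrolled_le (a := fun i =>
      ∫ ω, ((Y (m + L + j) ω * Y (m + L) ω - c j : ℝ) : ℂ) * Z (m + i) ω ^ (q + 1) ∂P)
    (b := 0) (w := μ ^ (q + 1)) (e := fun _ => 2 * B ^ 2 * (23 * (d * B)))
    (by rw [norm_pow, h.norm_eq, one_pow]) L fun i _ => by
      rw [Pi.zero_apply, add_zero]
      exact h.norm_integral_rotation_le hH hM (m + i) hq
  have h0 := h.corr_pair m L j (q + 1) hL (by omega)
  simp only [Pi.zero_apply, mul_zero, Finset.sum_const_zero, sub_zero, Finset.sum_const,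
    Finset.card_range, nsmul_eq_mul, add_zero] at hu
  set x := ∫ ω, ((Y (m + L + j) ω * Y (m + L) ω - c j : ℝ) : ℂ) * Z (m + L) ω ^ (q + 1) ∂P
  set y := ∫ ω, ((Y (m + L + j) ω * Y (m + L) ω - c j : ℝ) : ℂ) * Z m ω ^ (q + 1) ∂P
  have h1 := norm_sub_norm_le x ((μ ^ (q + 1)) ^ L * y)
  rw [norm_mul, norm_pow, norm_pow, h.norm_eq, one_pow, one_pow, one_mul] at h1
  linarith

/-- Products of two values of the potential are decorrelated from the orbit. -/
theorem norm_integral_pair_le (h : CorrelatedOrbit P Y Z c μ d B K α) (m j : ℕ) {L : ℕ}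
    (hL : 1 ≤ L) :
    ‖∫ ω, (Y (m + L + j) ω : ℂ) * ((Y (m + L) ω : ℂ) * (1 + Z (m + L) ω) ^ 2) ∂P
      - (c j : ℂ) * ∫ ω, (1 + Z (m + L) ω) ^ 2 ∂P‖
      ≤ 3 * K * (L : ℝ) ^ (-α) + 138 * L * B ^ 3 * d := by
  have hH : Measurable fun ω => Y (m + L + j) ω * Y (m + L) ω - c j :=
    ((h.measY _).mul (h.measY _)).sub_const _
  have hM : ∀ ω, |Y (m + L + j) ω * Y (m + L) ω - c j| ≤ 2 * B ^ 2 := fun ω => by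
    have h1 := abs_sub (Y (m + L + j) ω * Y (m + L) ω) (c j)
    rw [abs_mul] at h1
    have h2 := mul_le_mul (h.absY (m + L + j) ω) (h.absY (m + L) ω) (abs_nonneg _) h.nonneg
    linarith [h.abs_cov_le_sq j]
  have i0 : Integrable (fun ω => ((Y (m + L + j) ω * Y (m + L) ω - c j : ℝ) : ℂ)) P :=
    integrable_of_measurable_of_norm_le (Complex.measurable_ofReal.comp hH) (M := 2 * B ^ 2)
      fun ω => by rw [Complex.norm_real]; exact hM ω
  have i1 := h.integrable_pow hH hM (m + L) (0 + 1)
  have i2 := h.integrable_pow hH hM (m + L) (1 + 1)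
  have i3 : Integrable (fun ω => (Y (m + L + j) ω : ℂ) * ((Y (m + L) ω : ℂ) *
      (1 + Z (m + L) ω) ^ 2)) P := by
    simpa using h.integrable_drift (h.measY (m + L + j)) (h.absY _) (m + L) 0
  have i4 : Integrable (fun ω => (1 + Z (m + L) ω) ^ 2) P := by
    have := h.measZ (m + L)
    exact integrable_of_measurable_of_norm_le (by fun_prop) (h.norm_one_add_sq_le (m + L))
  have iY : Integrable (fun ω => Y (m + L + j) ω * Y (m + L) ω) P :=
    integrable_of_measurable_of_norm_le ((h.measY _).mul (h.measY _)) (M := B * B) fun ω => by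
      rw [norm_mul]
      exact mul_le_mul (h.absY _ ω) (h.absY _ ω) (norm_nonneg _) h.nonneg
  have h0 : ∫ ω, ((Y (m + L + j) ω * Y (m + L) ω - c j : ℝ) : ℂ) ∂P = 0 := by
    rw [integral_complex_ofReal, integral_sub iY (integrable_const _), h.cov]
    simp
  have i5 : Integrable (fun ω => ((Y (m + L + j) ω * Y (m + L) ω - c j : ℝ) : ℂ)
      + 2 * (((Y (m + L + j) ω * Y (m + L) ω - c j : ℝ) : ℂ) * Z (m + L) ω ^ (0 + 1))) P :=
    i0.add (i1.const_mul _)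
  have e1 : ∫ ω, (Y (m + L + j) ω : ℂ) * ((Y (m + L) ω : ℂ) * (1 + Z (m + L) ω) ^ 2) ∂P
      - (c j : ℂ) * ∫ ω, (1 + Z (m + L) ω) ^ 2 ∂P
      = 0 + 2 * ∫ ω, ((Y (m + L + j) ω * Y (m + L) ω - c j : ℝ) : ℂ) * Z (m + L) ω ^ (0 + 1) ∂P
        + ∫ ω, ((Y (m + L + j) ω * Y (m + L) ω - c j : ℝ) : ℂ) * Z (m + L) ω ^ (1 + 1) ∂P := by
    rw [← h0, ← integral_const_mul, ← integral_const_mul, ← integral_sub i3 (i4.const_mul _),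
      ← integral_add i0 (i1.const_mul _), ← integral_add i5 i2]
    refine integral_congr_ae (ae_of_all _ fun ω => ?_)
    push_cast
    ring
  rw [e1]
  refine norm_add₃_le.trans ?_
  rw [norm_mul, Complex.norm_ofNat, norm_zero]
  linarith [h.norm_integral_pair_mul_pow_le m j (q := 0) hL (by omega),
    h.norm_integral_pair_mul_pow_le m j (q := 1) hL le_rfl]

theorem norm_integral_mul_sub_le (h : CorrelatedOrbit P Y Z c μ d B K α) (m : ℕ) {L : ℕ}
    (hL : 1 ≤ L) :
    ‖Complex.I * d * ∫ ω, (Y (m + L + L) ω : ℂ) * Z (m + L + L) ω ∂P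
      - d ^ 2 * ∑ i ∈ Finset.range L, μ ^ (L - i) * ((c (L - i) : ℂ) *
        ∫ ω, (1 + Z (m + L + i) ω) ^ 2 ∂P)‖
      ≤ d * (K * (L : ℝ) ^ (-α) + L * (B * (120 * (d * B) ^ 2)))
        + d ^ 2 * (L * (3 * K * (L : ℝ) ^ (-α) + 138 * L * B ^ 3 * d)) := by
  have hs := fun i => h.norm_integral_step_le (h.measY (m + L + L)) (h.absY _) (m + L + i)
    (q := 0) (by omega)
  have h0 := h.corr (m + L) L 1 hL (by omega)
  simp only [zero_add, pow_one, pow_zero, one_mul, Nat.cast_zero, mul_one] at hs h0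
  have hu := norm_sub_unrolled_le
    (a := fun i => ∫ ω, (Y (m + L + L) ω : ℂ) * Z (m + L + i) ω ∂P)
    (b := fun i => -Complex.I * d * ∫ ω, (Y (m + L + L) ω : ℂ) * ((Y (m + L + i) ω : ℂ) *
      (1 + Z (m + L + i) ω) ^ 2) ∂P)
    (w := μ) (e := fun _ => B * (120 * (d * B) ^ 2)) h.norm_eq L fun i _ => hs i
  simp only [add_zero, Finset.sum_const, Finset.card_range, nsmul_eq_mul] at hu
  refine norm_sub_sum_le_of_unrolled (C := fun j => (c j : ℂ))
    (F := fun i => ∫ ω, (1 + Z (m + L + i) ω) ^ 2 ∂P)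
    (G := fun i => ∫ ω, (Y (m + L + L) ω : ℂ) * ((Y (m + L + i) ω : ℂ) *
      (1 + Z (m + L + i) ω) ^ 2) ∂P) h.norm_eq h.pos.le h0 hu fun i hi => ?_
  have h1 := h.norm_integral_pair_le (m + i) (L - i) hL
  rwa [show m + i + L + (L - i) = m + L + L by omega, show m + i + L = m + L + i by omega] at h1

theorem cesaroBound_second_order (h : CorrelatedOrbit P Y Z c μ d B K α) (hK : 0 ≤ K)
    (hα : 1 < α) {L : ℕ} (hL : 1 ≤ L) {g : ℝ}
    (hg : CesaroBound (fun n => ∫ ω, (1 + Z n ω) ^ 2 ∂P - 1) g) (hg0 : 0 ≤ g) :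
    CesaroBound (fun n => Complex.I * d * ∫ ω, (Y n ω : ℂ) * Z n ω ∂P
        + d ^ 2 / 2 * ∫ ω, (Y n ω : ℂ) * ((Y n ω : ℂ) * (1 + Z n ω) ^ 2) ∂P
        - d ^ 2 * (c 0 / 2 + ∑ i ∈ Finset.range L, μ ^ (L - i) * c (L - i)))
      (d * (K * (L : ℝ) ^ (-α) + L * (B * (120 * (d * B) ^ 2)))
        + d ^ 2 * ((L + 1) * (3 * K * (L : ℝ) ^ (-α) + 138 * L * B ^ 3 * d))
        + d ^ 2 * ((K * ∑' n : ℕ, (n : ℝ) ^ (-α) + B ^ 2) * g)) := by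
  have hd := h.pos
  have hB := h.nonneg
  have hS : 0 ≤ ∑' n : ℕ, (n : ℝ) ^ (-α) := tsum_nonneg fun n => by positivity
  refine CesaroBound.of_shift (by positivity) (L + L) ?_
  have n2 : ‖(d : ℂ) ^ 2‖ = d ^ 2 := by
    rw [norm_pow, Complex.norm_real, Real.norm_eq_abs, abs_of_pos hd]
  have n3 : ‖(d : ℂ) ^ 2 / 2‖ = d ^ 2 / 2 := by rw [norm_div, n2, Complex.norm_ofNat]
  have c1 := CesaroBound.of_norm_le fun m => h.norm_integral_mul_sub_le m hL
  have c2 := (CesaroBound.of_norm_le fun m => h.norm_integral_pair_le (m + L) 0 hL).const_mul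
    ((d : ℂ) ^ 2 / 2)
  have c3 := (CesaroBound.finset_sum (Finset.range L) fun i _ =>
    (hg.shift (L + i)).const_mul (μ ^ (L - i) * c (L - i))).const_mul ((d : ℂ) ^ 2)
  have c4 := (hg.shift (L + L)).const_mul ((d : ℂ) ^ 2 / 2 * c 0)
  refine (((c1.add c2).add (c3.add c4)).mono ?_).congr_fun fun m => ?_
  · rw [norm_mul, n2, n3, Complex.norm_real, ← Finset.sum_mul]
    have hs : ∑ i ∈ Finset.range L, ‖μ ^ (L - i) * (c (L - i) : ℂ)‖
        ≤ K * ∑' n : ℕ, (n : ℝ) ^ (-α) := by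
      refine le_trans (le_of_eq (Finset.sum_congr rfl fun i _ => ?_)) (h.sum_abs_cov_le hK hα L)
      rw [norm_mul, norm_pow, h.norm_eq, one_pow, one_mul, Complex.norm_real, Real.norm_eq_abs]
    have h0 : ‖c 0‖ ≤ B ^ 2 := h.abs_cov_le_sq 0
    have g1 : d ^ 2 * ((∑ i ∈ Finset.range L, ‖μ ^ (L - i) * (c (L - i) : ℂ)‖) * g)
        ≤ d ^ 2 * ((K * ∑' n : ℕ, (n : ℝ) ^ (-α)) * g) := by gcongr
    have g2 : d ^ 2 / 2 * ‖c 0‖ * g ≤ d ^ 2 * 1 * B ^ 2 * g := by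
      gcongr
      linarith [sq_nonneg d]
    have g3 : 0 ≤ d ^ 2 * (3 * K * (L : ℝ) ^ (-α) + 138 * L * B ^ 3 * d) := by positivity
    linarith
  · simp only [add_zero, ← add_assoc, mul_sub, mul_one, Finset.sum_sub_distrib, mul_assoc]
    ring

/-- The second order expansion of the expected logarithmic growth. -/
theorem abs_integral_log_sub_le (h : CorrelatedOrbit P Y Z c μ d B K α) (n : ℕ) :
    |∫ ω, Real.log ‖1 + Complex.I * (d * Y n ω : ℝ) * (1 + Z n ω)‖ ∂P
      - (Complex.I * d * ∫ ω, (Y n ω : ℂ) * Z n ω ∂P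
        + d ^ 2 / 2 * ∫ ω, (Y n ω : ℂ) * ((Y n ω : ℂ) * (1 + Z n ω) ^ 2) ∂P).re|
      ≤ 8 * (d * B) ^ 3 := by
  have mY := h.measY n
  have mZ := h.measZ n
  set w := fun ω => Complex.I * (d * Y n ω : ℝ) * (1 + Z n ω) with hw
  have mw : Measurable w := by
    have : Measurable fun ω => ((d * Y n ω : ℝ) : ℂ) :=
      Complex.measurable_ofReal.comp (mY.const_mul d)
    exact (this.const_mul _).mul (mZ.const_add 1)
  have bw : ∀ ω, ‖w ω‖ ≤ 2 * (d * B) := fun ω =>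
    (norm_I_mul_mul_le (h.normZ n ω)).trans (by linarith [h.abs_drive_le n ω])
  have hsm := h.small
  have bq : ∀ ω, ‖w ω - w ω ^ 2 / 2‖ ≤ 1 := fun ω => by
    refine (norm_sub_le _ _).trans ?_
    rw [norm_div, norm_pow, Complex.norm_ofNat]
    nlinarith [bw ω, norm_nonneg (w ω)]
  have hlog : ∀ ω, |Real.log ‖1 + w ω‖ - (w ω - w ω ^ 2 / 2).re| ≤ 8 * (d * B) ^ 3 := fun ω => by
    refine (abs_log_norm_sub_le ((bw ω).trans (by linarith))).trans ?_
    calc ‖w ω‖ ^ 3 ≤ (2 * (d * B)) ^ 3 := by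
          gcongr
          exact bw ω
      _ = _ := by ring
  have mq : Measurable fun ω => w ω - w ω ^ 2 / 2 := by fun_prop
  have iq : Integrable (fun ω => w ω - w ω ^ 2 / 2) P := integrable_of_measurable_of_norm_le mq bq
  have ml : Measurable fun ω => Real.log ‖1 + w ω‖ :=
    Real.measurable_log.comp (mw.const_add 1).norm
  have il : Integrable (fun ω => Real.log ‖1 + w ω‖) P :=
    integrable_of_measurable_of_norm_le ml (M := 8 * (d * B) ^ 3 + 1) fun ω => by
      have h1 := (Complex.abs_re_le_norm _).trans (bq ω)
      have h2 := abs_sub_abs_le_abs_sub (Real.log ‖1 + w ω‖) (w ω - w ω ^ 2 / 2).re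
      rw [Real.norm_eq_abs]
      linarith [hlog ω]
  have i1 : Integrable (fun ω => (Y n ω : ℂ)) P := by
    simpa using h.integrable_pow (h.measY n) (h.absY n) n 0
  have i2 : Integrable (fun ω => (Y n ω : ℂ) * Z n ω) P := by
    simpa using h.integrable_pow (h.measY n) (h.absY n) n 1
  have i3 : Integrable (fun ω => (Y n ω : ℂ) * ((Y n ω : ℂ) * (1 + Z n ω) ^ 2)) P := by
    simpa using h.integrable_drift (h.measY n) (h.absY n) n 0
  have i12 : Integrable (fun ω => Complex.I * d * Y n ω + Complex.I * d * ((Y n ω : ℂ) * Z n ω))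
    P := (i1.const_mul _).add (i2.const_mul _)
  have e0 : ∫ ω, (Y n ω : ℂ) ∂P = 0 := by
    rw [integral_complex_ofReal, h.mean, Complex.ofReal_zero]
  have e1 : Complex.I * d * ∫ ω, (Y n ω : ℂ) * Z n ω ∂P
      + d ^ 2 / 2 * ∫ ω, (Y n ω : ℂ) * ((Y n ω : ℂ) * (1 + Z n ω) ^ 2) ∂P
      = ∫ ω, (w ω - w ω ^ 2 / 2) ∂P := by
    have e2 : ∫ ω, (w ω - w ω ^ 2 / 2) ∂P = ∫ ω, (Complex.I * d * Y n ω
        + Complex.I * d * ((Y n ω : ℂ) * Z n ω)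
        + d ^ 2 / 2 * ((Y n ω : ℂ) * ((Y n ω : ℂ) * (1 + Z n ω) ^ 2))) ∂P := by
      refine integral_congr_ae (ae_of_all _ fun ω => ?_)
      simp only [hw]
      push_cast
      linear_combination (-((d : ℂ) * Y n ω * (1 + Z n ω)) ^ 2 / 2) * Complex.I_sq
    rw [e2, integral_add i12 (i3.const_mul _), integral_add (i1.const_mul _) (i2.const_mul _),
      integral_const_mul, integral_const_mul, integral_const_mul, e0, mul_zero, zero_add]
  rw [e1]
  have e3 : (∫ ω, (w ω - w ω ^ 2 / 2) ∂P).re = ∫ ω, (w ω - w ω ^ 2 / 2).re ∂P :=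
    (integral_re iq).symm
  have ir : Integrable (fun ω => (w ω - w ω ^ 2 / 2).re) P := iq.re
  rw [e3, ← integral_sub il ir, ← Real.norm_eq_abs]
  exact norm_integral_le_of_forall_norm_le hlog

end CorrelatedOrbit

/-! ### Comparison with the spectral density -/

theorem rpow_neg_le_mul_rpow_neg {L n α s : ℝ} (hL : 0 < L) (hn : L ≤ n) (hs : 0 ≤ s) :
    n ^ (-α) ≤ L ^ (-s) * n ^ (-(α - s)) := by
  have hn0 : 0 < n := hL.trans_le hn
  have h1 : n ^ (-α) = n ^ (-s) * n ^ (-(α - s)) := by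
    rw [← Real.rpow_add hn0]
    congr 1
    ring
  rw [h1]
  exact mul_le_mul_of_nonneg_right (Real.rpow_le_rpow_of_nonpos hL hn (by linarith))
    (by positivity)

theorem abs_tsum_tail_le {c : ℕ → ℝ} {K α s : ℝ} (hc : ∀ j, 1 ≤ j → |c j| ≤ K * (j : ℝ) ^ (-α))
    (hK : 0 ≤ K) (hs : 0 ≤ s) (hα : 1 < α - s) {L : ℕ} (hL : 1 ≤ L) :
    |∑' j : ℕ, c (j + L + 1)| ≤ K * (∑' n : ℕ, (n : ℝ) ^ (-(α - s))) * (L : ℝ) ^ (-s) := by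
  have hsum : Summable fun n : ℕ => (n : ℝ) ^ (-(α - s)) :=
    Real.summable_nat_rpow.2 (by linarith)
  have hL0 : (0 : ℝ) < L := by exact_mod_cast hL
  have h1 : ∀ j : ℕ, ‖c (j + L + 1)‖
      ≤ K * (L : ℝ) ^ (-s) * ((j + (L + 1) : ℕ) : ℝ) ^ (-(α - s)) := fun j => by
    refine (hc (j + L + 1) (by omega)).trans ?_
    rw [mul_assoc]
    refine mul_le_mul_of_nonneg_left (rpow_neg_le_mul_rpow_neg hL0 ?_ hs) hK
    exact_mod_cast (by omega : L ≤ j + L + 1)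
  have h2 := (summable_nat_add_iff (L + 1)).2 hsum
  have h3 := tsum_of_norm_bounded ((h2.mul_left (K * (L : ℝ) ^ (-s))).hasSum) h1
  rw [tsum_mul_left] at h3
  refine h3.trans ?_
  have h4 : ∑' j : ℕ, ((j + (L + 1) : ℕ) : ℝ) ^ (-(α - s)) ≤ ∑' n : ℕ, (n : ℝ) ^ (-(α - s)) := by
    rw [← hsum.sum_add_tsum_nat_add (L + 1)]
    have : 0 ≤ ∑ i ∈ Finset.range (L + 1), (i : ℝ) ^ (-(α - s)) :=
      Finset.sum_nonneg fun i _ => by positivity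
    linarith
  have h5 := mul_le_mul_of_nonneg_left h4 (by positivity : 0 ≤ K * (L : ℝ) ^ (-s))
  linarith

theorem abs_re_rotated_sum_sub_le {c : ℕ → ℝ} {μ : ℂ} {K α s : ℝ} (hμ : ‖μ‖ = 1)
    (hc : ∀ j, 1 ≤ j → |c j| ≤ K * (j : ℝ) ^ (-α)) (hK : 0 ≤ K) (hs : 0 ≤ s) (hα : 2 < α)
    (hsα : 1 < α - s) {L : ℕ} (hL : 1 ≤ L) :
    |((c 0 : ℂ) / 2 + ∑ i ∈ Finset.range L, μ ^ (L - i) * (c (L - i) : ℂ)).re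
      - (c 0 + 2 * ∑' j : ℕ, c (j + 1)) / 2|
      ≤ K * ‖1 - μ‖ * (∑' n : ℕ, (n : ℝ) ^ (-(α - 1)))
        + K * (∑' n : ℕ, (n : ℝ) ^ (-(α - s))) * (L : ℝ) ^ (-s) := by
  have hsum : Summable fun j : ℕ => c (j + 1) := by
    have h1 : Summable fun n : ℕ => (n : ℝ) ^ (-α) := Real.summable_nat_rpow.2 (by linarith)
    exact Summable.of_norm_bounded (((summable_nat_add_iff 1).2 h1).mul_left K) fun j =>
      hc (j + 1) (by omega)
  have h1 : ∑ i ∈ Finset.range L, μ ^ (L - i) * (c (L - i) : ℂ)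
      = ∑ i ∈ Finset.range L, μ ^ (i + 1) * (c (i + 1) : ℂ) := by
    rw [← Finset.sum_range_reflect]
    refine Finset.sum_congr rfl fun i hi => ?_
    have := Finset.mem_range.1 hi
    rw [show L - (L - 1 - i) = i + 1 by omega]
  have h2 := norm_sum_le_of_le (Finset.range L)
    (f := fun i => (μ ^ (i + 1) - 1) * (c (i + 1) : ℂ))
    (n := fun i => K * ‖1 - μ‖ * ((i + 1 : ℕ) : ℝ) ^ (-(α - 1))) fun i _ => by
      have h3 := norm_one_sub_pow_le hμ (i + 1)
      have h4 := hc (i + 1) (by omega)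
      rw [norm_mul, norm_sub_rev, Complex.norm_real, Real.norm_eq_abs]
      refine (mul_le_mul h3 h4 (abs_nonneg _) (by positivity)).trans (le_of_eq ?_)
      have h5 : ((i + 1 : ℕ) : ℝ) ^ (-(α - 1)) = ((i + 1 : ℕ) : ℝ) ^ (-α) * ((i + 1 : ℕ) : ℝ) := by
        rw [← Real.rpow_add_one (by positivity)]
        congr 1
        ring
      rw [h5]
      ring
  rw [← Finset.mul_sum] at h2
  have h6 := mul_le_mul_of_nonneg_left (sum_range_succ_rpow_le (s := α - 1) (by linarith) L)
    (by positivity : 0 ≤ K * ‖1 - μ‖)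
  have h7 := (Complex.abs_re_le_norm _).trans (h2.trans h6)
  have h8 := abs_tsum_tail_le hc hK hs hsα hL
  have h9 := hsum.sum_add_tsum_nat_add L
  have e1 : ((c 0 : ℂ) / 2 + ∑ i ∈ Finset.range L, μ ^ (L - i) * (c (L - i) : ℂ)).re
      - (c 0 + 2 * ∑' j : ℕ, c (j + 1)) / 2
      = (∑ i ∈ Finset.range L, (μ ^ (i + 1) - 1) * (c (i + 1) : ℂ)).re
        - ∑' j : ℕ, c (j + L + 1) := by
    rw [h1, ← h9, Complex.add_re]
    have e2 : (∑ i ∈ Finset.range L, (μ ^ (i + 1) - 1) * (c (i + 1) : ℂ))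
        = ∑ i ∈ Finset.range L, μ ^ (i + 1) * (c (i + 1) : ℂ)
          - ((∑ i ∈ Finset.range L, c (i + 1) : ℝ) : ℂ) := by
      push_cast
      rw [← Finset.sum_sub_distrib]
      exact Finset.sum_congr rfl fun i _ => by ring
    rw [e2, Complex.sub_re, Complex.ofReal_re, ← Complex.ofReal_ofNat, ← Complex.ofReal_div,
      Complex.ofReal_re]
    ring
  rw [e1]
  exact (abs_sub _ _).trans (add_le_add h7 h8)

theorem second_order_error_le {d B K R σ t T S S₁ S₂ r₁ L ν : ℝ} (hd : 0 < d) (hB : 0 ≤ B)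
    (hK : 0 ≤ K) (hR : 0 ≤ R) (hσ : 0 < σ) (ht : 0 ≤ t) (hS : 0 ≤ S) (hS₁ : 0 ≤ S₁)
    (hL : 1 ≤ L) (htR : t ≤ R * d) (hLR : d * L ≤ R) (hν : ν ≤ 2 * σ) (hr₁ : 0 ≤ r₁)
    (hS₂ : 0 ≤ S₂)
    (hT : T = K * R + 12 * K * S + 120 * B ^ 3 * R) :
    d * (K * t + L * (B * (120 * (d * B) ^ 2)))
      + d ^ 2 * ((L + 1) * (3 * K * t + 138 * L * B ^ 3 * d))
      + d ^ 2 * ((K * S + B ^ 2) * (3 * ((120 * (d * B) ^ 2 + 8 * d *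
        (K * t + 12 * d * K * S + L * (B * (120 * (d * B) ^ 2)))) / σ)))
      + 8 * (d * B) ^ 3 + d ^ 2 * (K * ν * S₁ + K * S₂ * r₁)
      ≤ (K + 6 * K * R + 404 * B ^ 3 + 3 * (K * S + B ^ 2) * (120 * B ^ 2 + 8 * T)
          + 2 * K * S₁ + K * S₂)
        * (d ^ 3 * L ^ 2 + d * t + d ^ 2 * r₁ + d ^ 2 * σ + d ^ 4 / σ) := by
  have a1 : d ^ 3 * L ≤ d ^ 3 * L ^ 2 := by
    gcongr
    nlinarith
  have a0 : d ^ 3 ≤ d ^ 3 * L ^ 2 := by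
    have : (1 : ℝ) ≤ L ^ 2 := one_le_pow₀ hL
    nlinarith [pow_pos hd 3]
  have a2 : d ^ 2 * L * t ≤ R * (d * t) := by
    have := mul_le_mul_of_nonneg_right hLR (by positivity : 0 ≤ d * t)
    linarith
  have a3 : d ^ 2 * ((L + 1) * (3 * K * t + 138 * L * B ^ 3 * d))
      ≤ 6 * K * (R * (d * t)) + 276 * B ^ 3 * (d ^ 3 * L ^ 2) := by
    calc _ ≤ d ^ 2 * ((2 * L) * (3 * K * t + 138 * L * B ^ 3 * d)) := by
          gcongr
          linarith
      _ = 6 * K * (d ^ 2 * L * t) + 276 * B ^ 3 * (d ^ 3 * L ^ 2) := by ring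
      _ ≤ _ := by gcongr
  have a4 : K * t + 12 * d * K * S + L * (B * (120 * (d * B) ^ 2)) ≤ T * d := by
    have h1 := mul_le_mul_of_nonneg_left htR hK
    have h2 := mul_le_mul_of_nonneg_left hLR (by positivity : 0 ≤ 120 * B ^ 3 * d)
    rw [hT]
    linarith
  have a5 : d ^ 2 * ((K * S + B ^ 2) * (3 * ((120 * (d * B) ^ 2 + 8 * d *
        (K * t + 12 * d * K * S + L * (B * (120 * (d * B) ^ 2)))) / σ)))
      ≤ 3 * (K * S + B ^ 2) * (120 * B ^ 2 + 8 * T) * (d ^ 4 / σ) := by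
    calc _ ≤ d ^ 2 * ((K * S + B ^ 2) * (3 * ((120 * (d * B) ^ 2 + 8 * d * (T * d)) / σ))) := by
          gcongr
      _ = _ := by ring
  have a6 : d ^ 2 * (K * ν * S₁ + K * S₂ * r₁)
      ≤ 2 * K * S₁ * (d ^ 2 * σ) + K * S₂ * (d ^ 2 * r₁) := by
    calc _ ≤ d ^ 2 * (K * (2 * σ) * S₁ + K * S₂ * r₁) := by gcongr
      _ = _ := by ring
  have hT0 : 0 ≤ T := by
    rw [hT]
    positivity
  have a7 := mul_le_mul_of_nonneg_left a1 (by positivity : 0 ≤ 120 * B ^ 3)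
  have a8 := mul_le_mul_of_nonneg_left a0 (by positivity : 0 ≤ 8 * B ^ 3)
  have x1 : 0 ≤ d ^ 3 * L ^ 2 := by positivity
  have x2 : 0 ≤ d * t := by positivity
  have x3 : 0 ≤ d ^ 2 * r₁ := by positivity
  have x4 : 0 ≤ d ^ 2 * σ := by positivity
  have x5 : 0 ≤ d ^ 4 / σ := by positivity
  have k1 : 0 ≤ 6 * K * R := by positivity
  have k2 : 0 ≤ 404 * B ^ 3 := by positivity
  have k3 : 0 ≤ 3 * (K * S + B ^ 2) * (120 * B ^ 2 + 8 * T) := by positivity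
  have k4 : 0 ≤ 2 * K * S₁ := by positivity
  have k5 : 0 ≤ K * S₂ := by positivity
  have split : ∀ {a b c e f g p q r s t : ℝ}, 0 ≤ a → 0 ≤ b → 0 ≤ c → 0 ≤ e → 0 ≤ f → 0 ≤ g →
      0 ≤ p → 0 ≤ q → 0 ≤ r → 0 ≤ s → 0 ≤ t →
      (a + b) * q + c * p + e * t + f * s + g * r
        ≤ (a + b + c + e + f + g) * (p + q + r + s + t) := by
    intro a b c e f g p q r s t ha hb hc he hf hg hp hq hr hs ht
    have e1 : (a + b + c + e + f + g) * (p + q + r + s + t)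
        = ((a + b) * q + c * p + e * t + f * s + g * r)
          + ((a + b) * (p + r + s + t) + c * (q + r + s + t) + e * (p + q + r + s)
            + f * (p + q + r + t) + g * (p + q + s + t)) := by ring
    rw [e1]
    exact le_add_of_nonneg_right (by positivity)
  have := split hK k1 k2 k3 k4 k5 x1 x2 x3 x4 x5
  linarith

/-- The mean logarithmic growth along a correlated orbit, to second order in the coupling. -/
theorem CorrelatedOrbit.exists_abs_growth_sub_le {B K α R : ℝ} (hB : 0 ≤ B) (hK : 0 ≤ K)
    (hα : 2 < α) (hR : 0 ≤ R) :
    ∃ C : ℝ, 0 ≤ C ∧ ∀ {Ω : Type*} [MeasurableSpace Ω] {P : Measure Ω} [IsProbabilityMeasure P]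
      {Y : ℕ → Ω → ℝ} {Z : ℕ → Ω → ℂ} {c : ℕ → ℝ} {μ : ℂ} {d : ℝ},
      CorrelatedOrbit P Y Z c μ d B K α → ∀ {σ : ℝ} {L : ℕ}, 0 < σ → σ ≤ ‖1 - μ‖ →
      ‖1 - μ‖ ≤ 2 * σ → σ ≤ ‖1 - μ ^ 2‖ → 1 ≤ L → (L : ℝ) ^ (-α) ≤ R * d → d * L ≤ R →
      CesaroBound (fun n => ((∫ ω, Real.log ‖1 + Complex.I * (d * Y n ω : ℝ) * (1 + Z n ω)‖ ∂P
          - d ^ 2 * (c 0 + 2 * ∑' j : ℕ, c (j + 1)) / 2 : ℝ) : ℂ))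
        (C * (d ^ 3 * L ^ 2 + d * (L : ℝ) ^ (-α) + d ^ 2 * (L : ℝ) ^ (-((α - 2) / 2))
          + d ^ 2 * σ + d ^ 4 / σ)) := by
  have hS : ∀ s : ℝ, 0 ≤ ∑' n : ℕ, (n : ℝ) ^ (-s) := fun s => tsum_nonneg fun n => by positivity
  refine ⟨K + 6 * K * R + 404 * B ^ 3 + 3 * (K * (∑' n : ℕ, (n : ℝ) ^ (-α)) + B ^ 2) *
      (120 * B ^ 2 + 8 * (K * R + 12 * K * (∑' n : ℕ, (n : ℝ) ^ (-α)) + 120 * B ^ 3 * R))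
      + 2 * K * (∑' n : ℕ, (n : ℝ) ^ (-(α - 1)))
      + K * (∑' n : ℕ, (n : ℝ) ^ (-(α - (α - 2) / 2))), ?_,
    fun {Ω _ P _ Y Z c μ d} h {σ L} hσ hμ1 hμ2 hμ3 hL ht hdL => ?_⟩
  · have := hS α
    have := hS (α - 1)
    have := hS (α - (α - 2) / 2)
    positivity
  · have hg := h.cesaroBound_one_add_sq
      (fun m p hp => h.norm_integral_mul_pow_le hK (by linarith) m hL hp) hσ hμ1 hμ3
    have hd := h.pos
    have c1 := (h.cesaroBound_second_order hK (by linarith) hL hg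
      (by have := hS α; positivity)).re
    have c2 : CesaroBound (fun n => ((∫ ω, Real.log ‖1 + Complex.I * (d * Y n ω : ℝ) *
        (1 + Z n ω)‖ ∂P - (Complex.I * d * ∫ ω, (Y n ω : ℂ) * Z n ω ∂P
        + d ^ 2 / 2 * ∫ ω, (Y n ω : ℂ) * ((Y n ω : ℂ) * (1 + Z n ω) ^ 2) ∂P).re : ℝ) : ℂ))
        (8 * (d * B) ^ 3) := CesaroBound.of_norm_le fun n => by
      rw [Complex.norm_real]
      exact h.abs_integral_log_sub_le n
    have c3 : CesaroBound (fun _ => ((d ^ 2 * (((c 0 : ℂ) / 2 + ∑ i ∈ Finset.range L,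
        μ ^ (L - i) * (c (L - i) : ℂ)).re - (c 0 + 2 * ∑' j : ℕ, c (j + 1)) / 2) : ℝ) : ℂ))
        (d ^ 2 * (K * ‖1 - μ‖ * (∑' n : ℕ, (n : ℝ) ^ (-(α - 1)))
          + K * (∑' n : ℕ, (n : ℝ) ^ (-(α - (α - 2) / 2))) * (L : ℝ) ^ (-((α - 2) / 2)))) :=
      CesaroBound.of_norm_le fun _ => by
        rw [Complex.norm_real, Real.norm_eq_abs, abs_mul, abs_of_nonneg (sq_nonneg d)]
        exact mul_le_mul_of_nonneg_left (abs_re_rotated_sum_sub_le h.norm_eq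
          (fun j hj => h.abs_cov_le hj) hK (by linarith) hα (by linarith) hL) (sq_nonneg d)
    refine (((c1.add c2).add c3).mono (second_order_error_le hd hB hK hR hσ (by positivity)
      (hS α) (hS _) (by exact_mod_cast hL) ht hdL hμ2 (by positivity) (hS _) rfl)).congr_fun
      fun n => ?_
    rw [← Complex.ofReal_add, ← Complex.ofReal_add, Complex.sub_re, ← Complex.ofReal_pow,
      Complex.re_ofReal_mul]
    congr 1
    ring

/-! ### The disk orbit and the transfer matrices -/

theorem Matrix.norm_fin_two (M : Matrix (Fin 2) (Fin 2) ℂ) :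
    ‖M‖ = max (max ‖M 0 0‖ ‖M 0 1‖) (max ‖M 1 0‖ ‖M 1 1‖) := by
  refine le_antisymm ((Matrix.norm_le_iff (by positivity)).2 fun i j => ?_) ?_
  · fin_cases i <;> fin_cases j <;> simp
  · simp [Matrix.norm_entry_le_entrywise_sup_norm]

theorem norm_eq_one_of_sq_add_sq {E σ : ℝ} {u : ℂ} (hu : u = E / 2 + σ * Complex.I)
    (hEσ : (E / 2) ^ 2 + σ ^ 2 = 1) : ‖u‖ = 1 := by
  have h1 : Complex.normSq u = 1 := by
    rw [hu, Complex.normSq_apply]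
    simp only [Complex.add_re, Complex.add_im, Complex.mul_re, Complex.mul_im, Complex.ofReal_re,
      Complex.ofReal_im, Complex.I_re, Complex.I_im, ← Complex.ofReal_ofNat,
      ← Complex.ofReal_div]
    linarith
  rw [Complex.normSq_eq_norm_sq] at h1
  nlinarith [norm_nonneg u]

section Transfer

variable {A : Type*} {lam : ℝ} {V : (ℤ → A) → ℝ}

theorem measurable_transferProd_apply [MeasurableSpace A] (hV : Measurable V) (E : ℂ) (N : ℕ)
    (i j : Fin 2) : Measurable fun ω => transferProd lam V E N ω i j := by
  induction N generalizing i j with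
  | zero => exact measurable_const
  | succ N ih =>
    have h1 : Measurable fun ω : ℤ → A => (V (shiftn (N + 1) ω) : ℂ) :=
      Complex.measurable_ofReal.comp (hV.comp (measurable_shiftn _))
    have h2 := ih 0 j
    have h3 := ih 1 j
    simp only [transferProd, transferMat, Matrix.mul_apply, Fin.sum_univ_two]
    fin_cases i <;> simp <;> fun_prop

theorem measurable_norm_transferProd [MeasurableSpace A] (hV : Measurable V) (E : ℂ) (N : ℕ) :
    Measurable fun ω => ‖transferProd lam V E N ω‖ := by
  have := measurable_transferProd_apply (lam := lam) hV E N
  simp only [Matrix.norm_fin_two]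
  exact ((this 0 0).norm.max (this 0 1).norm).max ((this 1 0).norm.max (this 1 1).norm)

theorem im_transferProd_apply (E : ℝ) (N : ℕ) (ω : ℤ → A) (i j : Fin 2) :
    (transferProd lam V E N ω i j).im = 0 := by
  induction N generalizing i j with
  | zero => fin_cases i <;> fin_cases j <;> simp [transferProd]
  | succ N ih =>
    have h2 := ih 0 j
    have h3 := ih 1 j
    simp only [transferProd, transferMat, Matrix.mul_apply, Fin.sum_univ_two]
    fin_cases i <;> simp [h2, h3]

/-- In modified Prüfer coordinates the transfer matrices act on the phase by `diskMap`. -/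
theorem exists_transferProd_eq {E σ : ℝ} {u : ℂ} (hu : u = E / 2 + σ * Complex.I)
    (hσ : 0 < σ) (hEσ : (E / 2) ^ 2 + σ ^ 2 = 1) (hB : ∀ ω, |lam / (2 * σ) * V ω| ≤ 1 / 8)
    (N : ℕ) (ω : ℤ → A) :
    ∃ a : ℂ, ‖a‖ = ∏ n ∈ Finset.range N, ‖1 + Complex.I *
        (lam / (2 * σ) * orbitPotential V n ω : ℝ) *
        (1 + diskOrbit ((starRingEnd ℂ u) ^ 2) (lam / (2 * σ)) V n ω)‖ ∧
      (transferProd lam V E N ω 0 0 * u + transferProd lam V E N ω 0 1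
        = a * (u * (1 + diskOrbit ((starRingEnd ℂ u) ^ 2) (lam / (2 * σ)) V N ω))) ∧
      (transferProd lam V E N ω 1 0 * u + transferProd lam V E N ω 1 1
        = a * (1 + u ^ 2 * diskOrbit ((starRingEnd ℂ u) ^ 2) (lam / (2 * σ)) V N ω)) := by
  set ub := starRingEnd ℂ u with hub
  have hub' : ub = E / 2 - σ * Complex.I := by
    rw [hub, hu]
    simp [sub_eq_add_neg, Complex.conj_ofNat]
  have hprod : u * ub = 1 := by
    rw [hub', hu]
    have : ((E / 2 : ℂ)) ^ 2 + (σ : ℂ) ^ 2 = 1 := by exact_mod_cast hEσ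
    linear_combination this - (σ : ℂ) ^ 2 * Complex.I_sq
  have hsum : (E : ℂ) = u + ub := by
    rw [hub', hu]
    ring
  have hdiff : u - ub = 2 * σ * Complex.I := by
    rw [hub', hu]
    ring
  have hnu := norm_eq_one_of_sq_add_sq hu hEσ
  have hnμ : ‖ub ^ 2‖ = 1 := by
    rw [norm_pow, hub, Complex.norm_conj, hnu, one_pow]
  induction N with
  | zero => exact ⟨1, by simp, by simp [transferProd, diskOrbit], by simp [transferProd, diskOrbit]⟩
  | succ N ih =>
    obtain ⟨a, ha, hx, hy⟩ := ih
    set z := diskOrbit (ub ^ 2) (lam / (2 * σ)) V N ω with hz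
    set v : ℝ := lam / (2 * σ) * orbitPotential V N ω with hv
    have hzn : ‖z‖ ≤ 1 := norm_diskOrbit_le_one hnμ hB N ω
    set w := 1 + Complex.I * v * (1 + z) with hw
    have h0 : w ≠ 0 := diskMap_denom_ne_zero hzn (hB (shiftn (N + 1) ω) : |v| ≤ 1 / 8)
    have hz' : w * diskOrbit (ub ^ 2) (lam / (2 * σ)) V (N + 1) ω
        = ub ^ 2 * (z - Complex.I * v * (1 + z)) := by
      rw [show diskOrbit (ub ^ 2) (lam / (2 * σ)) V (N + 1) ω = diskMap (ub ^ 2) v z from rfl,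
        diskMap, ← hw, mul_left_comm, mul_sub, mul_div_cancel₀ _ h0, hw]
      ring
    have hvl : Complex.I * v * (u - ub) = -(lam * (V (shiftn (N + 1) ω) : ℂ)) := by
      have h1 : 2 * σ * v = lam * V (shiftn (N + 1) ω) := by
        rw [hv, orbitPotential]
        field_simp
      rw [hdiff, ← Complex.ofReal_mul, ← h1]
      push_cast
      linear_combination (2 * σ * v : ℂ) * Complex.I_sq
    have t0 : ∀ j, transferProd lam V E (N + 1) ω 0 j
        = (E - lam * V (shiftn (N + 1) ω)) * transferProd lam V E N ω 0 j
          - transferProd lam V E N ω 1 j := fun j => by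
      simp [transferProd, transferMat, Matrix.mul_apply, Fin.sum_univ_two, sub_eq_add_neg]
    have t1 : ∀ j, transferProd lam V E (N + 1) ω 1 j = transferProd lam V E N ω 0 j := fun j => by
      simp [transferProd, transferMat, Matrix.mul_apply, Fin.sum_univ_two]
    refine ⟨a * (u * w), ?_, ?_, ?_⟩
    · rw [Finset.prod_range_succ, ← ha, norm_mul, norm_mul, hnu, one_mul]
    · rw [t0, t0]
      set z' := diskOrbit (ub ^ 2) (lam / (2 * σ)) V (N + 1) ω
      set x0 := transferProd lam V E N ω 0 0
      set x1 := transferProd lam V E N ω 0 1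
      set y0 := transferProd lam V E N ω 1 0
      set y1 := transferProd lam V E N ω 1 1
      have e1 : u * w * (u * (1 + z')) = u ^ 2 * w + u ^ 2 * (w * z') := by ring
      have e2 : a * (u * w) * (u * (1 + z')) = a * (u * w * (u * (1 + z'))) := by ring
      rw [e2, e1, hz', hw, hsum, ← sub_eq_zero]
      have e3 : (u + ub - lam * V (shiftn (N + 1) ω)) = u + ub + Complex.I * v * (u - ub) := by
        rw [hvl]
        ring
      rw [e3]
      linear_combination (u + ub + Complex.I * v * (u - ub)) * hx - hy
        + a * (1 + z - Complex.I * v * (1 + z) - (u * ub + 1) * (z - Complex.I * v * (1 + z)))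
          * hprod
    · rw [t1, t1, hx]
      set z' := diskOrbit (ub ^ 2) (lam / (2 * σ)) V (N + 1) ω
      have e1 : a * (u * w) * (1 + u ^ 2 * z') = a * u * (w + u ^ 2 * (w * z')) := by ring
      rw [e1, hz', hw]
      linear_combination (-a * u * (u * ub + 1) * (z - Complex.I * v * (1 + z))) * hprod

theorem norm_transferProd_bounds {E σ : ℝ} {u : ℂ} (hu : u = E / 2 + σ * Complex.I)
    (hσ : 0 < σ) (hEσ : (E / 2) ^ 2 + σ ^ 2 = 1) (hB : ∀ ω, |lam / (2 * σ) * V ω| ≤ 1 / 8)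
    (N : ℕ) (ω : ℤ → A) {p : ℝ} (hp : p = ∏ n ∈ Finset.range N, ‖1 + Complex.I *
        (lam / (2 * σ) * orbitPotential V n ω : ℝ) *
        (1 + diskOrbit ((starRingEnd ℂ u) ^ 2) (lam / (2 * σ)) V n ω)‖) :
    σ / 2 * p ≤ ‖transferProd lam V E N ω‖ ∧
      ‖transferProd lam V E N ω‖ ≤ (2 + 2 / σ) * p := by
  obtain ⟨a, ha, hx, hy⟩ := exists_transferProd_eq hu hσ hEσ hB N ω
  rw [← hp] at ha
  have hnu := norm_eq_one_of_sq_add_sq hu hEσ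
  have hub : ‖starRingEnd ℂ u‖ = 1 := by rw [Complex.norm_conj, hnu]
  have hprod : u * starRingEnd ℂ u = 1 := by
    rw [Complex.mul_conj', hnu]
    simp
  have hdiff : u - starRingEnd ℂ u = 2 * σ * Complex.I := by
    rw [hu]
    simp [Complex.conj_ofNat]
    ring
  have ndiff : ‖u - starRingEnd ℂ u‖ = 2 * σ := by
    rw [hdiff]
    simp [abs_of_pos hσ]
  have hz : ‖diskOrbit ((starRingEnd ℂ u) ^ 2) (lam / (2 * σ)) V N ω‖ ≤ 1 :=
    norm_diskOrbit_le_one (by rw [norm_pow, hub, one_pow]) hB N ω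
  set z := diskOrbit ((starRingEnd ℂ u) ^ 2) (lam / (2 * σ)) V N ω
  have him := im_transferProd_apply (lam := lam) (V := V) E N ω
  have hent : ∀ i j, ‖transferProd lam V E N ω i j‖ ≤ ‖transferProd lam V E N ω‖ := fun i j =>
    Matrix.norm_entry_le_entrywise_sup_norm _
  set T := transferProd lam V E N ω
  have row : ∀ {s t x : ℂ}, s.im = 0 → t.im = 0 → s * u + t = x → ‖x‖ ≤ 2 * p →
      ‖s‖ ≤ (2 + 2 / σ) * p ∧ ‖t‖ ≤ (2 + 2 / σ) * p := by
    intro s t x hs ht hx hxp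
    have hp0 : 0 ≤ p := by linarith [norm_nonneg x]
    have h1 : s * starRingEnd ℂ u + t = starRingEnd ℂ x := by
      rw [← hx, map_add, map_mul, Complex.conj_eq_iff_im.2 hs, Complex.conj_eq_iff_im.2 ht]
    have h2 : s * (u - starRingEnd ℂ u) = x - starRingEnd ℂ x := by
      rw [← h1, ← hx]
      ring
    have h3 : ‖s‖ * (2 * σ) ≤ 4 * p := by
      rw [← ndiff, ← norm_mul, h2]
      refine (norm_sub_le _ _).trans ?_
      rw [Complex.norm_conj]
      linarith
    have h4 : ‖s‖ ≤ 2 / σ * p := by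
      rw [div_mul_eq_mul_div, le_div_iff₀ hσ]
      linarith
    have h5 : ‖t‖ ≤ ‖x‖ + ‖s‖ := by
      have := norm_sub_le x (s * u)
      rw [norm_mul, hnu, mul_one, ← hx] at this
      rw [← hx]
      simpa using this
    constructor <;> linarith
  have h1z := norm_one_add_le_two hz
  constructor
  · have e1 : (T 0 0 * u + T 0 1) - starRingEnd ℂ u * (T 1 0 * u + T 1 1)
        = a * (u - starRingEnd ℂ u) := by
      rw [hx, hy]
      linear_combination (-a * u * z) * hprod
    have h1 : p * (2 * σ) = ‖(T 0 0 * u + T 0 1) - starRingEnd ℂ u * (T 1 0 * u + T 1 1)‖ := by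
      rw [e1, norm_mul, ha, ndiff]
    have h2 := norm_sub_le (T 0 0 * u + T 0 1) (starRingEnd ℂ u * (T 1 0 * u + T 1 1))
    have h3 := norm_add_le (T 0 0 * u) (T 0 1)
    have h4 := norm_add_le (T 1 0 * u) (T 1 1)
    rw [norm_mul, hub, one_mul] at h2
    rw [norm_mul, hnu, mul_one] at h3 h4
    linarith [hent 0 0, hent 0 1, hent 1 0, hent 1 1]
  · have r0 := row (him 0 0) (him 0 1) hx (by
      rw [norm_mul, norm_mul, ha, hnu, one_mul, mul_comm]
      exact mul_le_mul_of_nonneg_right h1z (ha ▸ norm_nonneg a))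
    have r1 := row (him 1 0) (him 1 1) hy (by
      rw [norm_mul, ha, mul_comm]
      refine mul_le_mul_of_nonneg_right ?_ (ha ▸ norm_nonneg a)
      exact norm_one_add_le_two (by rw [norm_mul, norm_pow, hnu, one_pow, one_mul]; exact hz))
    rw [Matrix.norm_fin_two]
    exact max_le (max_le r0.1 r0.2) (max_le r1.1 r1.2)

theorem abs_log_sub_log_le {s t a b : ℝ} (ht : 0 < t) (ha : 0 < a) (hb : 0 < b)
    (h1 : a * t ≤ s) (h2 : s ≤ b * t) : |Real.log s - Real.log t| ≤ |Real.log a| + |Real.log b| := by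
  have hs : 0 < s := lt_of_lt_of_le (by positivity) h1
  have l1 := Real.log_le_log (by positivity) h1
  have l2 := Real.log_le_log hs h2
  rw [Real.log_mul ha.ne' ht.ne'] at l1
  rw [Real.log_mul hb.ne' ht.ne'] at l2
  rw [abs_le]
  constructor <;>
    linarith [neg_abs_le (Real.log a), le_abs_self (Real.log b), abs_nonneg (Real.log a),
      abs_nonneg (Real.log b)]

/-- The Lyapunov exponent is the mean logarithmic growth along the disk orbit. -/
theorem IsLyapunov.tendsto_growth [MeasurableSpace A] {P : Measure (ℤ → A)}
    [IsProbabilityMeasure P] (hV : Measurable V) {E σ γ : ℝ} {u : ℂ}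
    (hγ : IsLyapunov P lam V E γ) (hu : u = E / 2 + σ * Complex.I)
    (hσ : 0 < σ) (hEσ : (E / 2) ^ 2 + σ ^ 2 = 1) (hB : ∀ ω, |lam / (2 * σ) * V ω| ≤ 1 / 8) :
    Tendsto (fun N : ℕ => (N : ℝ)⁻¹ * ∑ n ∈ Finset.range N, ∫ ω, Real.log ‖1 + Complex.I *
        (lam / (2 * σ) * orbitPotential V n ω : ℝ) *
        (1 + diskOrbit ((starRingEnd ℂ u) ^ 2) (lam / (2 * σ)) V n ω)‖ ∂P) atTop (nhds γ) := by
  have hnμ : ‖(starRingEnd ℂ u) ^ 2‖ = 1 := by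
    rw [norm_pow, Complex.norm_conj, norm_eq_one_of_sq_add_sq hu hEσ, one_pow]
  set g : ℕ → (ℤ → A) → ℝ := fun n ω => ‖1 + Complex.I *
    (lam / (2 * σ) * orbitPotential V n ω : ℝ) *
    (1 + diskOrbit ((starRingEnd ℂ u) ^ 2) (lam / (2 * σ)) V n ω)‖ with hg
  have hz := fun n ω => norm_diskOrbit_le_one (V := V) hnμ hB n ω
  have hglow : ∀ n ω, 1 / 2 ≤ g n ω := fun n ω => by
    have h1 := le_norm_diskMap_denom (v := lam / (2 * σ) * orbitPotential V n ω) (hz n ω)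
    have h2 : |lam / (2 * σ) * orbitPotential V n ω| ≤ 1 / 8 := hB _
    exact le_trans (by linarith) h1
  have hgup : ∀ n ω, g n ω ≤ 2 := fun n ω => by
    have h1 := norm_I_mul_mul_le (v := lam / (2 * σ) * orbitPotential V n ω) (hz n ω)
    have h2 : |lam / (2 * σ) * orbitPotential V n ω| ≤ 1 / 8 := hB _
    refine (norm_add_le _ _).trans ?_
    rw [norm_one]
    linarith
  have hgm : ∀ n, Measurable (g n) := fun n => by
    have h1 : Measurable fun ω => ((lam / (2 * σ) * orbitPotential V n ω : ℝ) : ℂ) :=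
      Complex.measurable_ofReal.comp ((measurable_orbitPotential hV n).const_mul _)
    have h2 := measurable_diskOrbit hV ((starRingEnd ℂ u) ^ 2) (lam / (2 * σ)) n
    exact (((h1.const_mul _).mul (h2.const_add 1)).const_add 1).norm
  have hgi : ∀ n, Integrable (fun ω => Real.log (g n ω)) P := fun n =>
    integrable_of_measurable_of_norm_le (Real.measurable_log.comp (hgm n)) (M := Real.log 2)
      fun ω => by
        have hp : 0 < g n ω := lt_of_lt_of_le (by norm_num) (hglow n ω)
        have h1 := Real.log_le_log (by norm_num) (hglow n ω)
        have h2 := Real.log_le_log hp (hgup n ω)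
        rw [one_div, Real.log_inv] at h1
        exact abs_le.2 ⟨h1, h2⟩
  set κ := |Real.log (σ / 2)| + |Real.log (2 + 2 / σ)|
  have hdiff : ∀ N ω, |Real.log ‖transferProd lam V E N ω‖
      - ∑ n ∈ Finset.range N, Real.log (g n ω)| ≤ κ := fun N ω => by
    have hpos : ∀ n ∈ Finset.range N, g n ω ≠ 0 := fun n _ =>
      (lt_of_lt_of_le (by norm_num) (hglow n ω)).ne'
    rw [← Real.log_prod hpos]
    obtain ⟨h1, h2⟩ := norm_transferProd_bounds hu hσ hEσ hB N ω rfl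
    exact abs_log_sub_log_le (Finset.prod_pos fun n _ => lt_of_lt_of_le (by norm_num) (hglow n ω))
      (by positivity) (by positivity) h1 h2
  have hmain : ∀ N, |∫ ω, Real.log ‖transferProd lam V E N ω‖ ∂P
      - ∑ n ∈ Finset.range N, ∫ ω, Real.log (g n ω) ∂P| ≤ κ := fun N => by
    have i1 : Integrable (fun ω => ∑ n ∈ Finset.range N, Real.log (g n ω)) P :=
      integrable_finsetSum _ fun n _ => hgi n
    have m1 : Measurable fun ω => Real.log ‖transferProd lam V E N ω‖ :=
      Real.measurable_log.comp (measurable_norm_transferProd hV E N)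
    have m2 : Measurable fun ω => ∑ n ∈ Finset.range N, Real.log (g n ω) :=
      Finset.measurable_sum _ fun n _ => Real.measurable_log.comp (hgm n)
    have i2 : Integrable (fun ω => Real.log ‖transferProd lam V E N ω‖
        - ∑ n ∈ Finset.range N, Real.log (g n ω)) P :=
      integrable_of_measurable_of_norm_le (m1.sub m2) (hdiff N)
    have i3 : Integrable (fun ω => Real.log ‖transferProd lam V E N ω‖) P := by
      refine (i2.add i1).congr (ae_of_all _ fun ω => ?_)
      simp only [Pi.add_apply, sub_add_cancel]
    rw [← integral_finsetSum _ fun n _ => hgi n, ← integral_sub i3 i1]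
    rw [← Real.norm_eq_abs]
    exact norm_integral_le_of_forall_norm_le fun ω => by
      rw [Real.norm_eq_abs]
      exact hdiff N ω
  have hlim : Tendsto (fun N : ℕ => (N : ℝ)⁻¹ * (∫ ω, Real.log ‖transferProd lam V E N ω‖ ∂P
      - ∑ n ∈ Finset.range N, ∫ ω, Real.log (g n ω) ∂P)) atTop (nhds 0) := by
    refine squeeze_zero_norm (a := fun N : ℕ => (N : ℝ)⁻¹ * κ) (fun N => ?_) ?_
    · rw [norm_mul, Real.norm_eq_abs, Real.norm_eq_abs, abs_of_nonneg (by positivity)]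
      exact mul_le_mul_of_nonneg_left (hmain N) (by positivity)
    · simpa using tendsto_inv_atTop_nhds_zero_nat.mul_const κ
  have := Tendsto.sub hγ hlim
  rw [sub_zero] at this
  refine this.congr fun N => ?_
  ring

end Transfer

/-! ### Below the band edge -/

theorem specDensity_zero {A : Type*} [MeasurableSpace A] {P : Measure (ℤ → A)}
    (hinv : MeasurePreserving (shiftn 1) P P) {V : (ℤ → A) → ℝ} (hV : Measurable V) {K α : ℝ}
    (hα : 1 < α) {c : ℕ → ℝ} (hc : ∀ j : ℕ, ∫ ω, V ω * V (shiftn j ω) ∂P = c j)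
    (hcov : ∀ j : ℕ, 1 ≤ j → |c j| ≤ K * (j : ℝ) ^ (-α)) :
    specDensity P V 0 = ((c 0 + 2 * ∑' j : ℕ, c (j + 1) : ℝ) : ℂ) := by
  have hneg : ∀ j : ℕ, ∫ ω, V ω * V (shiftn (-(j : ℤ)) ω) ∂P = c j := fun j => by
    rw [← hc, ← integral_comp_shiftn hinv j (g := fun ω => V ω * V (shiftn (-(j : ℤ)) ω))
      (hV.mul (hV.comp (measurable_shiftn _)))]
    refine integral_congr_ae (ae_of_all _ fun ω => ?_)
    simp only [shiftn_shiftn, neg_add_cancel, shiftn_zero]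
    exact mul_comm _ _
  have hs : Summable c := by
    have h1 : Summable fun j : ℕ => K * (j : ℝ) ^ (-α) :=
      (Real.summable_nat_rpow.2 (by linarith)).mul_left K
    rw [← summable_nat_add_iff 1]
    refine Summable.of_norm_bounded ((summable_nat_add_iff 1).2 h1) fun j => ?_
    exact hcov (j + 1) (by omega)
  have hs1 := (summable_nat_add_iff 1).2 hs
  have h1 : HasSum (fun n : ℤ => ∫ ω, V ω * V (shiftn n ω) ∂P)
      (∑' j : ℕ, c j + ∑' j : ℕ, c (j + 1)) := by
    refine HasSum.of_nat_of_neg_add_one ?_ ?_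
    · simp only [hc]
      exact hs.hasSum
    · have h1 : ∀ j : ℕ, ∫ ω, V ω * V (shiftn (-((j : ℤ) + 1)) ω) ∂P = c (j + 1) := fun j => by
        rw [← hneg (j + 1)]
        push_cast
        rfl
      simp only [h1]
      exact hs1.hasSum
  have h2 : specDensity P V 0 = ((∑' n : ℤ, ∫ ω, V ω * V (shiftn n ω) ∂P : ℝ) : ℂ) := by
    rw [Complex.ofReal_tsum]
    simp [specDensity]
  rw [h2, h1.tsum_eq, hs.tsum_eq_zero_add]
  congr 1
  ring

/-- The window length balancing the errors of the expansion. -/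
theorem exists_window {q α : ℝ} (hq : 0 < q) (hq1 : q ≤ 1) (hα : 2 ≤ α) :
    ∃ L : ℕ, 1 ≤ L ∧ q * L ≤ 2 ∧ (L : ℝ) ^ (-α) ≤ q ∧
      q ^ 3 * (L : ℝ) ^ 2 ≤ 4 * q ^ ((3 * α + 2) / (α + 2)) ∧
      q * (L : ℝ) ^ (-α) ≤ q ^ ((3 * α + 2) / (α + 2)) ∧
      q ^ 2 * (L : ℝ) ^ (-((α - 2) / 2)) ≤ q ^ ((3 * α + 2) / (α + 2)) := by
  have hα2 : 0 < α + 2 := by linarith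
  set t := q ^ (-(2 / (α + 2))) with ht
  have ht1 : 1 ≤ t := Real.one_le_rpow_of_pos_of_le_one_of_nonpos hq hq1 (by
    rw [neg_nonpos]
    positivity)
  have ht0 : 0 < t := by linarith
  have hle : t ≤ ⌈t⌉₊ := Nat.le_ceil t
  have hlt : (⌈t⌉₊ : ℝ) ≤ 2 * t := by linarith [Nat.ceil_lt_add_one ht0.le]
  have hpow : ∀ s : ℝ, t ^ s = q ^ (-(2 / (α + 2)) * s) := fun s => by
    rw [ht, Real.rpow_mul hq.le]
  have hanti : ∀ s : ℝ, 0 ≤ s → (⌈t⌉₊ : ℝ) ^ (-s) ≤ q ^ (2 / (α + 2) * s) := fun s hs => by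
    refine (Real.rpow_le_rpow_of_nonpos ht0 hle (by linarith)).trans_eq ?_
    rw [hpow]
    ring_nf
  refine ⟨⌈t⌉₊, Nat.one_le_ceil_iff.2 ht0, ?_, ?_, ?_, ?_, ?_⟩
  · have h1 : q * t ≤ 1 := by
      have : q * t = q ^ (1 + -(2 / (α + 2))) := by rw [Real.rpow_add hq, Real.rpow_one]
      rw [this]
      refine Real.rpow_le_one hq.le hq1 ?_
      have : 2 / (α + 2) ≤ 1 := (div_le_one hα2).2 (by linarith)
      linarith
    nlinarith
  · refine (hanti α (by linarith)).trans ?_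
    conv_rhs => rw [← Real.rpow_one q]
    refine Real.rpow_le_rpow_of_exponent_ge hq hq1 ?_
    rw [div_mul_eq_mul_div, le_div_iff₀ hα2]
    linarith
  · have h1 : q ^ 3 * t ^ 2 = q ^ ((3 * α + 2) / (α + 2)) := by
      rw [← Real.rpow_natCast q, ← Real.rpow_natCast t, hpow, ← Real.rpow_add hq]
      congr 1
      push_cast
      field_simp
      ring
    have h2 : (⌈t⌉₊ : ℝ) ^ 2 ≤ (2 * t) ^ 2 := pow_le_pow_left₀ (Nat.cast_nonneg _) hlt 2
    have h3 := mul_le_mul_of_nonneg_left h2 (pow_pos hq 3).le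
    rw [← h1]
    linarith
  · refine (mul_le_mul_of_nonneg_left (hanti α (by linarith)) hq.le).trans_eq ?_
    conv_lhs => rw [← Real.rpow_one_add' hq.le (by positivity)]
    congr 1
    field_simp
    ring
  · refine (mul_le_mul_of_nonneg_left (hanti ((α - 2) / 2) (by linarith)) (sq_nonneg q)).trans_eq ?_
    rw [← Real.rpow_natCast q, ← Real.rpow_add hq]
    congr 1
    push_cast
    field_simp
    ring

/-- The size of the rotation angle and of its double at energy `2 - x`. -/
theorem norm_one_sub_conj_sq {x σ : ℝ} {u : ℂ} (hx1 : x ≤ 1) (hσ : 0 < σ)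
    (hu : u = ((2 - x : ℝ) : ℂ) / 2 + σ * Complex.I) (hEσ : ((2 - x) / 2) ^ 2 + σ ^ 2 = 1) :
    ‖1 - (starRingEnd ℂ u) ^ 2‖ = 2 * σ ∧ σ ≤ ‖1 - ((starRingEnd ℂ u) ^ 2) ^ 2‖ := by
  have hnu := norm_eq_one_of_sq_add_sq hu hEσ
  have hprod : u * starRingEnd ℂ u = 1 := by
    rw [Complex.mul_conj', hnu]
    simp
  have hdiff : u - starRingEnd ℂ u = (2 * σ : ℝ) * Complex.I := by
    rw [Complex.sub_conj, hu]
    simp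
  have hsum : u + starRingEnd ℂ u = (2 - x : ℝ) := by
    rw [Complex.add_conj, hu]
    simp
    ring
  have h1 : ‖1 - (starRingEnd ℂ u) ^ 2‖ = 2 * σ := by
    rw [show 1 - (starRingEnd ℂ u) ^ 2 = starRingEnd ℂ u * (u - starRingEnd ℂ u) by
      linear_combination -hprod, norm_mul, Complex.norm_conj, hnu, hdiff]
    rw [norm_mul, Complex.norm_I, Complex.norm_real, Real.norm_eq_abs, abs_of_pos (by positivity)]
    ring
  refine ⟨h1, ?_⟩
  have h2 : ‖1 + (starRingEnd ℂ u) ^ 2‖ = 2 - x := by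
    rw [show 1 + (starRingEnd ℂ u) ^ 2 = starRingEnd ℂ u * (u + starRingEnd ℂ u) by
      linear_combination -hprod, norm_mul, Complex.norm_conj, hnu, hsum, Complex.norm_real,
      Real.norm_eq_abs, abs_of_pos (by linarith), one_mul]
  rw [show 1 - ((starRingEnd ℂ u) ^ 2) ^ 2 = (1 - (starRingEnd ℂ u) ^ 2) *
    (1 + (starRingEnd ℂ u) ^ 2) by ring, norm_mul, h1, h2]
  nlinarith

theorem eventually_mul_rpow_le {a p δ : ℝ} (hp : 0 < p) (hδ : 0 < δ) :
    ∀ᶠ s : ℝ in nhds 0, a * s ^ p ≤ δ := by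
  have h1 : Tendsto (fun s : ℝ => a * s ^ p) (nhds 0) (nhds (a * 0 ^ p)) :=
    ((Real.continuousAt_rpow_const 0 p (Or.inr hp.le)).tendsto).const_mul a
  rw [Real.zero_rpow hp.ne', mul_zero] at h1
  exact (h1.eventually_lt_const hδ).mono fun s hs => hs.le

/-- The effective coupling `d` and the rotation angle `σ` at energy `2 - x`. -/
theorem coupling_bounds {M q κ d x σ : ℝ} (hM : 0 < M) (hq : 0 < q) (hκ : 0 < κ)
    (hx : 0 < x) (hx1 : x ≤ 1) (hxκ : x * M ^ 2 = κ ^ 2) (hσ : 0 < σ)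
    (hσ2 : σ ^ 2 = x * (1 - x / 4)) (hdσ : 2 * σ * d = q * κ) :
    M * σ ≤ κ ∧ κ ≤ 2 * (M * σ) ∧ d ≤ M * q ∧ M * q ≤ 2 * d ∧
      d ^ 2 * (4 - x) = q ^ 2 * M ^ 2 := by
  have hMσ : (M * σ) ^ 2 = κ ^ 2 * (1 - x / 4) := by
    rw [mul_pow, hσ2, ← hxκ]
    ring
  have hκ2 : 0 < κ ^ 2 := pow_pos hκ 2
  have hup : M * σ ≤ κ := by
    have h1 : (M * σ) ^ 2 ≤ κ ^ 2 := by nlinarith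
    exact (pow_le_pow_iff_left₀ (by positivity) hκ.le two_ne_zero).1 h1
  have hlow : κ ≤ 2 * (M * σ) := by
    have h1 : κ ^ 2 ≤ (2 * (M * σ)) ^ 2 := by nlinarith
    exact (pow_le_pow_iff_left₀ hκ.le (by positivity) two_ne_zero).1 h1
  refine ⟨hup, hlow, ?_, ?_, ?_⟩
  · refine le_of_mul_le_mul_left (a := 2 * σ) ?_ (by positivity)
    have := mul_le_mul_of_nonneg_left hlow hq.le
    linarith
  · refine le_of_mul_le_mul_left (a := σ) ?_ hσ
    have := mul_le_mul_of_nonneg_left hup hq.le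
    linarith
  · have h1 : (2 * σ * d) ^ 2 = (q * κ) ^ 2 := by rw [hdσ]
    have h2 : x * (d ^ 2 * (4 - x)) = x * (q ^ 2 * M ^ 2) := by
      linear_combination h1 - 4 * d ^ 2 * hσ2 - q ^ 2 * hxκ
    exact mul_left_cancel₀ hx.ne' h2

theorem error_terms_le {M q κ d σ α ρ : ℝ} {L : ℕ} (hM : 0 < M) (hq : 0 < q) (hκ : 0 < κ)
    (hd : 0 < d) (hσ : 0 < σ) (hdM : d ≤ M * q) (hσup : M * σ ≤ κ) (hσlow : κ ≤ 2 * (M * σ))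
    (e1 : q ^ 3 * (L : ℝ) ^ 2 ≤ 4 * q ^ ρ) (e2 : q * (L : ℝ) ^ (-α) ≤ q ^ ρ)
    (e3 : q ^ 2 * (L : ℝ) ^ (-((α - 2) / 2)) ≤ q ^ ρ) :
    q ^ 2 * κ ≤ q ^ 4 / κ + κ ^ 3 + q ^ ρ ∧
      d ^ 3 * (L : ℝ) ^ 2 + d * (L : ℝ) ^ (-α) + d ^ 2 * (L : ℝ) ^ (-((α - 2) / 2))
        + d ^ 2 * σ + d ^ 4 / σ ≤
      (4 * M ^ 3 + 2 * M + M ^ 2 + 2 * M ^ 5) * (q ^ 4 / κ + κ ^ 3 + q ^ ρ) := by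
  have hsplit : 2 * (q ^ 2 * κ) ≤ q ^ 4 / κ + κ ^ 3 := by
    have h1 : q ^ 4 / κ + κ ^ 3 - 2 * (q ^ 2 * κ) = (q ^ 2 - κ ^ 2) ^ 2 / κ := by
      field_simp
      ring
    have h2 : 0 ≤ (q ^ 2 - κ ^ 2) ^ 2 / κ := by positivity
    linarith
  have t1 : d ^ 3 * (L : ℝ) ^ 2 ≤ 4 * M ^ 3 * q ^ ρ := by
    have h1 : d ^ 3 * (L : ℝ) ^ 2 ≤ (M * q) ^ 3 * (L : ℝ) ^ 2 := by gcongr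
    have h2 := mul_le_mul_of_nonneg_left e1 (pow_pos hM 3).le
    linarith
  have t2 : d * (L : ℝ) ^ (-α) ≤ M * q ^ ρ := by
    have h1 : d * (L : ℝ) ^ (-α) ≤ M * q * (L : ℝ) ^ (-α) := by gcongr
    have h2 := mul_le_mul_of_nonneg_left e2 hM.le
    linarith
  have t3 : d ^ 2 * (L : ℝ) ^ (-((α - 2) / 2)) ≤ M ^ 2 * q ^ ρ := by
    have h1 : d ^ 2 * (L : ℝ) ^ (-((α - 2) / 2)) ≤ (M * q) ^ 2 * (L : ℝ) ^ (-((α - 2) / 2)) := by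
      gcongr
    have h2 := mul_le_mul_of_nonneg_left e3 (sq_nonneg M)
    linarith
  have t4 : d ^ 2 * σ ≤ M * (q ^ 2 * κ) := by
    have h1 : d ^ 2 * σ ≤ (M * q) ^ 2 * σ := by gcongr
    have h2 : M * q ^ 2 * (M * σ) ≤ M * q ^ 2 * κ := by gcongr
    linarith
  have t5 : d ^ 4 / σ ≤ 2 * M ^ 5 * (q ^ 4 / κ) := by
    rw [div_le_iff₀ hσ]
    have h1 : d ^ 4 ≤ (M * q) ^ 4 := by gcongr
    have h2 : 2 * M ^ 5 * (q ^ 4 / κ) * σ = (M * q) ^ 4 * (2 * (M * σ) / κ) := by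
      field_simp
    have h3 : 1 ≤ 2 * (M * σ) / κ := (one_le_div hκ).2 hσlow
    rw [h2]
    exact h1.trans (le_mul_of_one_le_right (by positivity) h3)
  have p1 : 0 < q ^ 4 / κ := by positivity
  have p2 : 0 < κ ^ 3 := by positivity
  have p3 : 0 < q ^ ρ := by positivity
  have p4 : 0 < q ^ 2 * κ := by positivity
  set S := q ^ 4 / κ + κ ^ 3 + q ^ ρ with hS
  have b1 : q ^ ρ ≤ S := by linarith
  have b2 : q ^ 4 / κ ≤ S := by linarith
  have b3 : q ^ 2 * κ ≤ S := by linarith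
  refine ⟨b3, ?_⟩
  have c1 : 4 * M ^ 3 * q ^ ρ ≤ 4 * M ^ 3 * S := by gcongr
  have c2 : M * q ^ ρ ≤ M * S := by gcongr
  have c3 : M ^ 2 * q ^ ρ ≤ M ^ 2 * S := by gcongr
  have c4 : M * (q ^ 2 * κ) ≤ M * S := by gcongr
  have c5 : 2 * M ^ 5 * (q ^ 4 / κ) ≤ 2 * M ^ 5 * S := by gcongr
  linarith

/-- Lyapunov exponent below the band edge: `γ_λ(2 − ελ^η) = λ^{2−η}·D_V(0)/(8ε) + errors`. -/
theorem belowBandEdge_lyapunov {A : Type*} [Countable A] [MeasurableSpace A]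
    (P : Measure (ℤ → A)) [IsProbabilityMeasure P]
    (hinv : MeasurePreserving (shiftn 1) P P)
    (r : ℝ) (hr : 0 < r) (hr1 : r < 1)
    (V : (ℤ → A) → ℝ) (hVmeas : Measurable V) (hVbdd : ∃ B, ∀ ω, |V ω| ≤ B)
    (hVql : QuasiLocal r V) (hVcent : ∫ ω, V ω ∂P = 0)
    (α : ℝ) (hα : 2 < α) (hmix : PowerMixing P α)
    (D0 : ℝ) (hD0 : specDensity P V 0 = (D0 : ℂ))
    (ε : ℝ) (hε : 0 < ε) (η : ℝ) (hη₁ : 4/5 < η) (hη₂ : η < 4/3) :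
    ∃ C > (0:ℝ), ∃ lam₀ > (0:ℝ), ∀ lam : ℝ, 0 < lam → lam < lam₀ → ∀ γ : ℝ,
      IsLyapunov P lam V ((2 - ε * lam ^ η : ℝ) : ℂ) γ →
      |γ - lam ^ (2 - η) * D0 / (8 * ε)| ≤
        C * (lam ^ (4 - 5*η/2) + lam ^ (3*η/2)
          + lam ^ ((1 - η/2) * ((3*α + 2)/(α + 2)))) := by
  obtain ⟨B₀, hB₀⟩ := hVbdd
  set B := max 1 B₀
  have hB1 : 1 ≤ B := le_max_left _ _
  have hB0 : 0 < B := by linarith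
  have hVb : ∀ ω, |V ω| ≤ B := fun ω => (hB₀ ω).trans (le_max_right _ _)
  obtain ⟨K, hK, β, hβ, horb⟩ := exists_correlatedOrbit hinv hr hr1 hVmeas hB1 hVb hVql hVcent
    (by linarith) hmix
  set c : ℕ → ℝ := fun j => ∫ ω, V ω * V (shiftn j ω) ∂P with hc
  have hcD : D0 = c 0 + 2 * ∑' j : ℕ, c (j + 1) := by
    have h1 := horb 1 (β / B) norm_one (by positivity) (div_mul_cancel₀ β hB0.ne').le
    rw [← Complex.ofReal_inj, ← hD0]
    exact specDensity_zero hinv hVmeas (by linarith) (fun _ => rfl) fun j hj => h1.abs_cov_le hj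
  set M := (Real.sqrt ε)⁻¹ with hM
  have hM0 : 0 < M := inv_pos.2 (Real.sqrt_pos.2 hε)
  have hMε : M ^ 2 * ε = 1 := by
    rw [hM, inv_pow, Real.sq_sqrt hε.le, inv_mul_cancel₀ hε.ne']
  obtain ⟨C, hC, hgrowth⟩ := CorrelatedOrbit.exists_abs_growth_sub_le (R := 2 / M + 2 * M) hB0.le hK
    hα (by positivity)
  have hev : ∀ᶠ s : ℝ in nhds 0, s ≤ 1 ∧ ε * s ^ η ≤ 1 ∧ (M * B) * s ^ (1 - η / 2) ≤ β :=
    (eventually_le_nhds one_pos).and ((eventually_mul_rpow_le (by linarith) one_pos).and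
      (eventually_mul_rpow_le (by linarith) hβ))
  obtain ⟨lam₀, hlam₀, hsmall⟩ := Metric.eventually_nhds_iff.1 hev
  refine ⟨C * (4 * M ^ 3 + 2 * M + M ^ 2 + 2 * M ^ 5) + |D0| + 1, by positivity, lam₀, hlam₀,
    fun lam hl0 hl γ hγ => ?_⟩
  obtain ⟨hl1, hx1, hdβ⟩ := hsmall (y := lam) (by rwa [Real.dist_eq, sub_zero, abs_of_pos hl0])
  set q := lam ^ (1 - η / 2) with hq
  set κ := lam ^ (η / 2) with hκ
  have hq0 : 0 < q := Real.rpow_pos_of_pos hl0 _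
  have hκ0 : 0 < κ := Real.rpow_pos_of_pos hl0 _
  have hq1 : q ≤ 1 := Real.rpow_le_one hl0.le hl1 (by linarith)
  have hκ1 : κ ≤ 1 := Real.rpow_le_one hl0.le hl1 (by linarith)
  have hκ2 : lam ^ η = κ ^ 2 := by
    rw [hκ, ← Real.rpow_mul_natCast hl0.le]
    congr 1
    push_cast
    ring
  have hκ3 : lam ^ (3 * η / 2) = κ ^ 3 := by
    rw [hκ, ← Real.rpow_mul_natCast hl0.le]
    congr 1
    push_cast
    ring
  have hq2 : lam ^ (2 - η) = q ^ 2 := by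
    rw [hq, ← Real.rpow_mul_natCast hl0.le]
    congr 1
    push_cast
    ring
  have hqκ : q * κ = lam := by
    rw [hq, hκ, ← Real.rpow_add hl0, sub_add_cancel, Real.rpow_one]
  have hq4 : lam ^ (4 - 5 * η / 2) = q ^ 4 / κ := by
    rw [eq_div_iff hκ0.ne', hq, hκ, ← Real.rpow_mul_natCast hl0.le, ← Real.rpow_add hl0]
    congr 1
    push_cast
    ring
  have hqρ : lam ^ ((1 - η / 2) * ((3 * α + 2) / (α + 2))) = q ^ ((3 * α + 2) / (α + 2)) :=
    Real.rpow_mul hl0.le _ _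
  rw [hq2, hq4, hκ3, hqρ]
  rw [hκ2] at hγ hx1
  set x := ε * κ ^ 2 with hx
  have hx0 : 0 < x := by positivity
  set σ := Real.sqrt (x * (1 - x / 4)) with hσ
  have hσ2 : σ ^ 2 = x * (1 - x / 4) := Real.sq_sqrt (by nlinarith)
  have hσ0 : 0 < σ := Real.sqrt_pos.2 (by nlinarith)
  have hEσ : ((2 - x) / 2) ^ 2 + σ ^ 2 = 1 := by
    rw [hσ2]
    ring
  have hxκ : x * M ^ 2 = κ ^ 2 := by
    rw [hx]
    linear_combination κ ^ 2 * hMε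
  set d := lam / (2 * σ) with hd
  have hd0 : 0 < d := by positivity
  have hdσ : 2 * σ * d = q * κ := by
    rw [hd, hqκ]
    field_simp
  obtain ⟨hσup, hσlow, hdup, hdlow, hdd⟩ := coupling_bounds hM0 hq0 hκ0 hx0 hx1 hxκ hσ0 hσ2 hdσ
  obtain ⟨hμ1, hμ2⟩ := norm_one_sub_conj_sq (u := ((2 - x : ℝ) : ℂ) / 2 + σ * Complex.I) hx1 hσ0
    rfl hEσ
  set u : ℂ := ((2 - x : ℝ) : ℂ) / 2 + σ * Complex.I with hu
  have hnu : ‖(starRingEnd ℂ u) ^ 2‖ = 1 := by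
    rw [norm_pow, Complex.norm_conj, norm_eq_one_of_sq_add_sq hu hEσ, one_pow]
  have hdB : d * B ≤ β := by
    have h1 := mul_le_mul_of_nonneg_right hdup hB0.le
    linarith
  have h := horb _ d hnu hd0 hdB
  have hlim := hγ.tendsto_growth hVmeas hu hσ0 hEσ fun ω => by
    rw [abs_mul, abs_of_pos hd0]
    exact (mul_le_mul_of_nonneg_left (hVb ω) hd0.le).trans h.small
  obtain ⟨L, hL, hqL, hLα, e1, e2, e3⟩ := exists_window hq0 hq1 hα.le
  have hces := (hgrowth h hσ0 (by linarith) hμ1.le hμ2 hL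
    (hLα.trans (by
      have h1 : q ≤ 2 / M * d := by
        rw [div_mul_eq_mul_div, le_div_iff₀ hM0]
        linarith
      have h2 : 0 < 2 * M * d := by positivity
      linarith))
    (by
      have h1 : d * L ≤ M * q * L := mul_le_mul_of_nonneg_right hdup (Nat.cast_nonneg _)
      have h2 := mul_le_mul_of_nonneg_left hqL hM0.le
      have h3 : 0 < 2 / M := by positivity
      linarith)).tendsto_re_le hlim
  rw [← hcD] at hces
  have hcenter : |d ^ 2 * D0 / 2 - q ^ 2 * D0 / (8 * ε)| ≤ |D0| * (q ^ 2 * κ) := by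
    have h1 : d ^ 2 * D0 / 2 - q ^ 2 * D0 / (8 * ε) = D0 * (d ^ 2 * x / 8) := by
      rw [show q ^ 2 * D0 / (8 * ε) = q ^ 2 * M ^ 2 * D0 / 8 by
        rw [eq_one_div_of_mul_eq_one_left hMε]
        field_simp, ← hdd]
      ring
    have h2 : d ^ 2 * x ≤ (M * q) ^ 2 * x := by gcongr
    have h3 : (M * q) ^ 2 * x = q ^ 2 * κ ^ 2 := by rw [← hxκ]; ring
    have h4 : q ^ 2 * κ ^ 2 ≤ q ^ 2 * κ :=
      mul_le_mul_of_nonneg_left (pow_le_of_le_one hκ0.le hκ1 two_ne_zero) (sq_nonneg q)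
    have h5 : 0 < d ^ 2 * x := by positivity
    rw [h1, abs_mul, abs_of_pos (by positivity : 0 < d ^ 2 * x / 8)]
    exact mul_le_mul_of_nonneg_left (by linarith) (abs_nonneg _)
  obtain ⟨b3, s1⟩ := error_terms_le hM0 hq0 hκ0 hd0 hσ0 hdup hσup hσlow e1 e2 e3
  set S := q ^ 4 / κ + κ ^ 3 + q ^ ((3 * α + 2) / (α + 2)) with hS
  have hS0 : 0 < S := by positivity
  have s2 := mul_le_mul_of_nonneg_left b3 (abs_nonneg D0)
  have s3 := mul_le_mul_of_nonneg_left s1 hC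
  have hfin := abs_sub_le γ (d ^ 2 * D0 / 2) (q ^ 2 * D0 / (8 * ε))
  linarith
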